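/- Under the stated hypotheses, the Hamming type 444 (K,K,K) three-term relation holds: A(1−a, e−a, f−a, g−a)·A(b, 1+b−e, 1+b−f, 1+b−g)·B_5(e−a, b, 1+b−f, g−a, 1+b−a, 1+b+c−f, 1+b+d−f)·K(a;b,c,d;e,f,g) + A(a, 1+a−e, f−d, g−d)·A(b, 1+b−e, f−c, g−c)·B_5(1+b−e, b, f−c, g−c, 1+a+b−e, 1+b−c, 1+b+d−e)·K(e−a; e−b, e−c, e−d; e, 1+e−f, 1+e−g) + A(a,b,c,d)·A(e−a, e−b, e−c, e−d)·B_5(a,b,c,d,e,f,g)·K(1+b−e; 1+a−e, 1+c−e, 1+d−e; 2−e, 1+f−e, 1+g−e) = 0. Here B_5(e−a,b,1+b−f,g−a,1+b−a,1+b+c−f,1+b+d−f) and B_5(1+b−e,b,f−c,g−c,1+a+b−e,1+b−c,1+b+d−e) denote the function B_5 evaluated at the indicated 7-tuples of arguments. -/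

import Mathlib

noncomputable section

open Complex

/-- `Sn x = sin (π x)`. -/
def Sn (x : ℂ) : ℂ := Complex.sin ((Real.pi : ℂ) * x)

/-- The renormalized Saalschützian series
`F*(a,b,c,d;e,f,g) = ∑ₖ Γ(k+a)Γ(k+b)Γ(k+c)Γ(k+d)/(k!·Γ(k+e)Γ(k+f)Γ(k+g))`. -/
def Fstar (a b c d e f g : ℂ) : ℂ :=
  ∑' k : ℕ, (Complex.Gamma (k + a) * Complex.Gamma (k + b) *
      Complex.Gamma (k + c) * Complex.Gamma (k + d)) /
    ((k.factorial : ℂ) * Complex.Gamma (k + e) * Complex.Gamma (k + f) *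
      Complex.Gamma (k + g))

/-- The function `K(a;b,c,d;e,f,g)`. -/
def Kf (a b c d e f g : ℂ) : ℂ :=
  (Fstar a b c d e f g +
      Fstar a (1 + a - e) (1 + a - f) (1 + a - g) (1 + a - b) (1 + a - c) (1 + a - d)) /
    (Sn a * Complex.Gamma a ^ 2 * Complex.Gamma b * Complex.Gamma c * Complex.Gamma d *
      Complex.Gamma (1 + a - e) * Complex.Gamma (1 + a - f) * Complex.Gamma (1 + a - g))

/-- The function `L(a,b,c,d;e;f,g)`. -/
def Lf (a b c d e f g : ℂ) : ℂ :=
  (Fstar a b c d e f g -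
      Fstar (1 + a - e) (1 + b - e) (1 + c - e) (1 + d - e) (2 - e) (1 + f - e) (1 + g - e)) /
    (Sn e * Complex.Gamma a * Complex.Gamma b * Complex.Gamma c * Complex.Gamma d *
      Complex.Gamma (1 + a - e) * Complex.Gamma (1 + b - e) * Complex.Gamma (1 + c - e) *
      Complex.Gamma (1 + d - e))

/-- `A(x,y,z,t) = 1/(Γ(x)Γ(y)Γ(z)Γ(t))`. -/
def Af (x y z t : ℂ) : ℂ :=
  1 / (Complex.Gamma x * Complex.Gamma y * Complex.Gamma z * Complex.Gamma t)

def B1 (a b c d e f g : ℂ) : ℂ :=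
  Sn b * Sn c * (Sn (b - a) * Sn (c - a) * Sn d + Sn (e - a) * Sn (f - a) * Sn (g - a)) /
    (Real.pi : ℂ) ^ 4

def B2 (a b c d e f g : ℂ) : ℂ :=
  Sn (f - a) * Sn (g - a) *
    (Sn (b - a) * Sn (c - a) * Sn (d - a) + Sn (e - 2 * a) * Sn (f - a) * Sn (g - a)) /
    (Real.pi : ℂ) ^ 4

def B3 (a b c d e f g : ℂ) : ℂ :=
  (Sn f * Sn (f - e) * Sn (g - a) * Sn (g - b) * Sn (g - c) * Sn (g - d) -
      Sn g * Sn (g - e) * Sn (f - a) * Sn (f - b) * Sn (f - c) * Sn (f - d)) /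
    ((Real.pi : ℂ) ^ 4 * Sn (f - g))

def B4 (a b c d e f g : ℂ) : ℂ :=
  Sn (f - a) * Sn (g - a) * (Sn b * Sn c * Sn d + Sn (e - a) * Sn f * Sn g) /
    (Real.pi : ℂ) ^ 4

def B5 (a b c d e f g : ℂ) : ℂ :=
  Sn b * Sn (e - b) *
    (Sn (b - a) * Sn (c - a) * Sn (d - a) + Sn (e - 2 * a) * Sn (f - a) * Sn (g - a)) /
    (Real.pi : ℂ) ^ 4

def Cf (a b c d e f g : ℂ) : ℂ :=
  Sn (e - a) * (Sn b * Sn c * Sn d * B2 a b c d e f g +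
      Sn e * Sn (f - a) * Sn (g - a) * B4 a b c d e f g) / (Real.pi : ℂ) ^ 4

open Filter Topology in
theorem Gamma_add_nat_add_one_div_tendsto (s : ℂ) (hs : ∀ m : ℕ, s ≠ -m) :
    Tendsto (fun n : ℕ => Gamma (s + n + 1) / ((n : ℂ) ^ s * (n.factorial : ℂ))) atTop (𝓝 1) := by
  have hg : Gamma s ≠ 0 := Gamma_ne_zero hs
  have h1 : Tendsto (fun n : ℕ => Gamma s / GammaSeq s n) atTop (𝓝 (Gamma s / Gamma s)) :=
    tendsto_const_nhds.div (GammaSeq_tendsto_Gamma s) hg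
  rw [div_self hg] at h1
  refine h1.congr' ?_
  filter_upwards [eventually_gt_atTop 0] with n hn
  have hprod : ∀ n : ℕ, Gamma (s + n + 1) = Gamma s * ∏ j ∈ Finset.range (n + 1), (s + j) := by
    intro n
    induction n with
    | zero =>
      have : s ≠ 0 := by simpa using hs 0
      simp [Gamma_add_one s this, mul_comm]
    | succ n ih =>
      have h0 : s + ((n + 1 : ℕ) : ℂ) ≠ 0 := fun h => hs (n + 1) (eq_neg_of_add_eq_zero_left h)
      rw [Gamma_add_one _ h0, Finset.prod_range_succ]
      have : s + ((n + 1 : ℕ) : ℂ) = s + n + 1 := by push_cast; ring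
      rw [this, ih]
      ring
  rw [hprod, GammaSeq, div_div_eq_mul_div]

theorem norm_log_one_add_sub_le {z : ℂ} (hz : ‖z‖ ≤ 1 / 2) : ‖log (1 + z) - z‖ ≤ ‖z‖ ^ 2 := by
  refine (norm_log_one_add_sub_self_le (by linarith)).trans ?_
  have h : (1 - ‖z‖)⁻¹ ≤ 2 := by
    rw [inv_le_comm₀ (by linarith) (by norm_num)]
    linarith
  nlinarith [sq_nonneg ‖z‖]

theorem norm_prod_add_div_add_le {ι : Type*} [Fintype ι] (u v : ι → ℂ)
    (hsum : ∑ j, u j = ∑ j, v j) {R : ℝ}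
    (hu : ∀ j, ‖u j‖ ≤ R) (hv : ∀ j, ‖v j‖ ≤ R) {t : ℂ} (ht : 2 * R ≤ ‖t‖) (ht0 : t ≠ 0) :
    ‖∏ j, ((t + v j) / (t + u j))‖ ≤
      Real.exp (2 * Fintype.card ι * R ^ 2 * (1 / ‖t‖ ^ 2)) := by
  have htpos : 0 < ‖t‖ := norm_pos_iff.mpr ht0
  have hsmall : ∀ w : ℂ, ‖w‖ ≤ R → ‖w / t‖ ≤ 1 / 2 := by
    intro w hw
    rw [norm_div, div_le_iff₀ htpos]
    linarith
  have hne : ∀ w : ℂ, ‖w‖ ≤ R → 1 + w / t ≠ 0 := by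
    intro w hw h
    have h2 : w / t = -1 := by linear_combination h
    have := hsmall w hw
    rw [h2] at this
    norm_num at this
  have hexp : ∏ j, ((t + v j) / (t + u j)) =
      exp (∑ j, (log (1 + v j / t) - v j / t - (log (1 + u j / t) - u j / t))) := by
    have h3 : ∑ j, (log (1 + v j / t) - v j / t - (log (1 + u j / t) - u j / t)) =
        ∑ j, (log (1 + v j / t) - log (1 + u j / t)) := by
      have : ∑ j, (v j / t) = ∑ j, (u j / t) := by
        rw [← Finset.sum_div, ← Finset.sum_div, hsum]
      simp only [Finset.sum_sub_distrib]
      rw [this]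
      ring
    rw [h3, exp_sum]
    refine Finset.prod_congr rfl fun j _ => ?_
    rw [exp_sub, exp_log (hne _ (hv j)), exp_log (hne _ (hu j))]
    have h4 := hne _ (hu j)
    have h5 : t + u j = t * (1 + u j / t) := by field_simp
    have h6 : t + v j = t * (1 + v j / t) := by field_simp
    rw [h5, h6, mul_div_mul_left _ _ ht0]
  rw [hexp, norm_exp]
  refine Real.exp_le_exp.mpr ((re_le_norm _).trans ?_)
  refine (norm_sum_le _ _).trans ?_
  have hb : ∀ w : ℂ, ‖w‖ ≤ R → ‖log (1 + w / t) - w / t‖ ≤ R ^ 2 * (1 / ‖t‖ ^ 2) := by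
    intro w hw
    refine (norm_log_one_add_sub_le (hsmall w hw)).trans ?_
    rw [norm_div, div_pow, div_eq_mul_one_div]
    gcongr
  have : ∀ j ∈ Finset.univ, ‖log (1 + v j / t) - v j / t - (log (1 + u j / t) - u j / t)‖ ≤
      2 * R ^ 2 * (1 / ‖t‖ ^ 2) := by
    intro j _
    refine (norm_sub_le _ _).trans ?_
    linarith [hb _ (hu j), hb _ (hv j)]
  refine (Finset.sum_le_card_nsmul _ _ _ this).trans (le_of_eq ?_)
  rw [nsmul_eq_mul, Finset.card_univ]
  ring

open Filter Topology in
theorem norm_prod_Gamma_div_le {ι : Type*} [Fintype ι] (u v : ι → ℂ)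
    (hsum : ∑ j, u j = ∑ j, v j) {R : ℝ} (hR : 0 < R)
    (hu : ∀ j, ‖u j‖ ≤ R) (hv : ∀ j, ‖v j‖ ≤ R) {t : ℂ} (ht : ∀ i : ℕ, 2 * R ≤ ‖t + i‖)
    {B : ℝ} (hB : ∀ n : ℕ, ∑ i ∈ Finset.range n, 1 / ‖t + i‖ ^ 2 ≤ B) :
    ‖∏ j, (Gamma (t + u j) / Gamma (t + v j))‖ ≤
      Real.exp (2 * Fintype.card ι * R ^ 2 * B) := by
  have ht0 : ∀ i : ℕ, t + i ≠ 0 := fun i h => by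
    have := ht i
    rw [h, norm_zero] at this
    linarith
  have hne : ∀ w : ℂ, ‖w‖ ≤ R → ∀ i : ℕ, t + w + i ≠ 0 := by
    intro w hw i h
    have h1 : t + i = -w := by linear_combination h
    have := ht i
    rw [h1, norm_neg] at this
    linarith
  set P : ℂ → ℂ := fun t => ∏ j, (Gamma (t + u j) / Gamma (t + v j)) with hP
  have hstep : ∀ n : ℕ, P t = P (t + n) *
      ∏ i ∈ Finset.range n, ∏ j, ((t + i + v j) / (t + i + u j)) := by
    intro n
    induction n with
    | zero => simp
    | succ n ih =>
      rw [ih, Finset.prod_range_succ, mul_comm (∏ i ∈ Finset.range n, _), ← mul_assoc]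
      congr 1
      simp only [hP]
      rw [← Finset.prod_mul_distrib]
      refine Finset.prod_congr rfl fun j _ => ?_
      have h1 := hne _ (hu j) n
      have h2 := hne _ (hv j) n
      have e1 : t + ((n + 1 : ℕ) : ℂ) + u j = (t + n + u j) + 1 := by push_cast; ring
      have e2 : t + ((n + 1 : ℕ) : ℂ) + v j = (t + n + v j) + 1 := by push_cast; ring
      have h1' : t + n + u j ≠ 0 := by rwa [add_right_comm]
      have h2' : t + n + v j ≠ 0 := by rwa [add_right_comm]
      rw [e1, e2, Gamma_add_one _ h1', Gamma_add_one _ h2']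
      by_cases hg : Gamma (t + n + v j) = 0
      · simp [hg]
      · field_simp
  have hlim : Tendsto (fun n : ℕ => P (t + ((n + 1 : ℕ) : ℂ))) atTop (𝓝 1) := by
    have h1 : ∀ w : ℂ, ‖w‖ ≤ R → ∀ m : ℕ, t + w ≠ -m := fun w hw m h =>
      hne w hw m (by rw [h]; ring)
    have h2 : Tendsto (fun n : ℕ => ∏ j,
        ((Gamma (t + u j + n + 1) / ((n : ℂ) ^ (t + u j) * (n.factorial : ℂ))) /
        (Gamma (t + v j + n + 1) / ((n : ℂ) ^ (t + v j) * (n.factorial : ℂ))))) atTop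
        (𝓝 (∏ _j : ι, (1 / 1 : ℂ))) :=
      tendsto_finsetProd _ fun j _ =>
        (Gamma_add_nat_add_one_div_tendsto _ (h1 _ (hu j))).div
          (Gamma_add_nat_add_one_div_tendsto _ (h1 _ (hv j))) one_ne_zero
    simp only [div_one, Finset.prod_const_one] at h2
    refine h2.congr' ?_
    filter_upwards [eventually_gt_atTop 0] with n hn
    have hn0 : (n : ℂ) ≠ 0 := by exact_mod_cast hn.ne'
    have hf : (n.factorial : ℂ) ≠ 0 := by exact_mod_cast n.factorial_ne_zero
    have hpow : ∏ j, ((n : ℂ) ^ (t + v j) / (n : ℂ) ^ (t + u j)) = 1 := by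
      have : ∀ j, (n : ℂ) ^ (t + v j) / (n : ℂ) ^ (t + u j) =
          exp (log n * (v j - u j)) := by
        intro j
        rw [← cpow_sub _ _ hn0, cpow_def_of_ne_zero hn0]
        congr 2
        ring
      simp only [this]
      rw [← exp_sum, ← Finset.mul_sum, Finset.sum_sub_distrib, hsum, sub_self, mul_zero, exp_zero]
    refine Eq.trans ?_ ((congrArg (P (t + ((n + 1 : ℕ) : ℂ)) * ·) hpow).trans (mul_one _))
    simp only [hP]
    rw [← Finset.prod_mul_distrib]
    refine Finset.prod_congr rfl fun j _ => ?_
    have e1 : t + u j + n + 1 = t + ((n + 1 : ℕ) : ℂ) + u j := by push_cast; ring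
    have e2 : t + v j + n + 1 = t + ((n + 1 : ℕ) : ℂ) + v j := by push_cast; ring
    rw [e1, e2]
    have p1 : (n : ℂ) ^ (t + v j) ≠ 0 := by simp [cpow_eq_zero_iff, hn0]
    have p2 : (n : ℂ) ^ (t + u j) ≠ 0 := by simp [cpow_eq_zero_iff, hn0]
    field_simp
  have hbound : ∀ n : ℕ, ‖P t‖ ≤
      ‖P (t + ((n + 1 : ℕ) : ℂ))‖ * Real.exp (2 * Fintype.card ι * R ^ 2 * B) := by
    intro n
    rw [hstep (n + 1), norm_mul]
    refine mul_le_mul_of_nonneg_left ?_ (norm_nonneg _)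
    rw [norm_prod]
    calc ∏ i ∈ Finset.range (n + 1), ‖∏ j, ((t + i + v j) / (t + i + u j))‖
        ≤ ∏ i ∈ Finset.range (n + 1),
          Real.exp (2 * Fintype.card ι * R ^ 2 * (1 / ‖t + i‖ ^ 2)) :=
          Finset.prod_le_prod (fun _ _ => norm_nonneg _) fun i _ =>
            norm_prod_add_div_add_le u v hsum hu hv (ht i) (ht0 i)
      _ = Real.exp (2 * Fintype.card ι * R ^ 2 *
          ∑ i ∈ Finset.range (n + 1), 1 / ‖t + i‖ ^ 2) := by
          rw [← Real.exp_sum, Finset.mul_sum]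
      _ ≤ _ := by
          refine Real.exp_le_exp.mpr (mul_le_mul_of_nonneg_left (hB _) (by positivity))
  have := ge_of_tendsto' (hlim.norm.mul_const (Real.exp (2 * Fintype.card ι * R ^ 2 * B))) hbound
  rwa [norm_one, one_mul] at this

/-- A constant bounding `∑ 1 / ‖t + i‖²` along any sequence `t, t + 1, t + 2, …` avoiding `0`. -/
def latticeBound : ℝ := ∑' m : ℤ, 1 / ((m : ℝ) ^ 2 / 2 + 1)

theorem summable_one_div_sq_half_add_one : Summable fun m : ℤ => 1 / ((m : ℝ) ^ 2 / 2 + 1) := by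
  have h : Summable fun m : ℤ => 2 * (1 / (m : ℝ) ^ 2) :=
    (Real.summable_one_div_int_pow.mpr (by norm_num : 1 < 2)).mul_left 2
  refine Summable.of_norm_bounded_eventually h ?_
  have h0 : ∀ᶠ m : ℤ in Filter.cofinite, m ≠ 0 := by
    simpa using (Set.finite_singleton (0 : ℤ)).eventually_cofinite_notMem
  filter_upwards [h0] with m hm
  have hm' : (0 : ℝ) < (m : ℝ) ^ 2 := by positivity
  rw [Real.norm_of_nonneg (by positivity), mul_one_div, div_le_div_iff₀ (by positivity) hm']
  linarith

theorem sum_range_le_latticeBound {t : ℂ} {m : ℤ}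
    (h : ∀ i : ℕ, ((m + i : ℤ) : ℝ) ^ 2 / 2 + 1 ≤ ‖t + i‖ ^ 2) (n : ℕ) :
    ∑ i ∈ Finset.range n, 1 / ‖t + i‖ ^ 2 ≤ latticeBound := by
  have h1 : ∑ i ∈ Finset.range n, 1 / ‖t + i‖ ^ 2 ≤
      ∑ i ∈ Finset.range n, 1 / (((m + i : ℤ) : ℝ) ^ 2 / 2 + 1) := by
    refine Finset.sum_le_sum fun i _ => one_div_le_one_div_of_le (by positivity) (h i)
  have hinj : Function.Injective fun i : ℕ => m + (i : ℤ) := fun i j hij => by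
    simpa using hij
  have h2 := Finset.sum_map (Finset.range n) ⟨fun i : ℕ => m + (i : ℤ), hinj⟩
    (fun m : ℤ => 1 / ((m : ℝ) ^ 2 / 2 + 1))
  simp only [Function.Embedding.coeFn_mk] at h2
  rw [← h2] at h1
  exact h1.trans (summable_one_div_sq_half_add_one.sum_le_tsum _ fun _ _ => by positivity)

theorem norm_prod_Gamma_ratio_le {x y : Fin 4 → ℂ} (hxy : ∑ j, x j + ∑ j, y j = 6) {R : ℝ}
    (hR : 1 ≤ R) (hx : ∀ j, ‖1 - x j‖ ≤ R) (hy : ∀ j, ‖y j‖ ≤ R) {t : ℂ}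
    (ht : ∀ i : ℕ, 2 * R ≤ ‖t + i‖) {m : ℤ}
    (h : ∀ i : ℕ, ((m + i : ℤ) : ℝ) ^ 2 / 2 + 1 ≤ ‖t + i‖ ^ 2) :
    ‖∏ j, (Gamma (t + (1 - x j)) / Gamma (t + y j))‖ ≤
      Real.exp (12 * R ^ 2 * latticeBound) * (1 / ‖t‖ ^ 2) := by
  have ht0 : t ≠ 0 := fun h0 => by
    have := ht 0
    simp [h0] at this
    linarith
  have hpos : ∀ i : ℕ, t + i ≠ 0 := fun i h0 => by
    have := ht i
    simp [h0] at this
    linarith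
  have key := norm_prod_Gamma_div_le (ι := Fin 4 ⊕ Fin 2)
    (Sum.elim (fun j => 1 - x j) (fun _ => 1)) (Sum.elim y (fun _ => 0))
    (by
      simp only [Fintype.sum_sum_type, Sum.elim_inl, Sum.elim_inr, Finset.sum_sub_distrib]
      simp
      linear_combination -hxy) (by linarith : 0 < R)
    (by rintro (j | j) <;> simp [hx, hR]) (by rintro (j | j) <;> simp [hy]; linarith)
    ht (sum_range_le_latticeBound h)
  have hcard : (Fintype.card (Fin 4 ⊕ Fin 2) : ℝ) = 6 := by norm_num
  have hG : Gamma t ≠ 0 := by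
    refine Gamma_ne_zero fun n hn => hpos n ?_
    rw [hn]
    ring
  simp only [Fintype.prod_sum_type, Sum.elim_inl, Sum.elim_inr, add_zero, hcard,
    Gamma_add_one t ht0, mul_div_cancel_right₀ t hG] at key
  rw [norm_mul] at key
  have h2 : ‖∏ _j : Fin 2, t‖ = ‖t‖ ^ 2 := by simp
  rw [h2] at key
  have htp : 0 < ‖t‖ ^ 2 := by positivity
  have h3 : 2 * 6 * R ^ 2 * latticeBound = 12 * R ^ 2 * latticeBound := by ring
  rw [h3] at key
  rwa [mul_one_div, le_div_iff₀ htp]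

/-- The general term of the bilateral series attached to the parameters `x`, `y`. -/
def bilatTerm (x y : Fin 4 → ℂ) (t : ℂ) : ℂ :=
  ∏ j, ((Gamma (x j - t))⁻¹ * (Gamma (y j + t))⁻¹)

/-- The bilateral series attached to the parameters `x`, `y`. -/
def bilat (x y : Fin 4 → ℂ) (s : ℂ) : ℂ := ∑' k : ℤ, bilatTerm x y (s + k)

theorem norm_sin_le_exp (z : ℂ) : ‖sin z‖ ≤ Real.exp |z.im| := by
  have h1 : ‖cexp (-z * I)‖ ≤ Real.exp |z.im| := by
    rw [norm_exp]
    refine Real.exp_le_exp.mpr ?_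
    simp [le_abs_self]
  have h2 : ‖cexp (z * I)‖ ≤ Real.exp |z.im| := by
    rw [norm_exp]
    refine Real.exp_le_exp.mpr ?_
    simp [neg_le_abs]
  rw [sin, norm_div, norm_mul, norm_I, mul_one]
  have h3 := norm_sub_le (cexp (-z * I)) (cexp (z * I))
  have : ‖(2 : ℂ)‖ = 2 := by simp
  rw [this]
  linarith

theorem bilatTerm_eq (x y : Fin 4 → ℂ) (t : ℂ) (h : ∀ j, ∀ i : ℕ, t + (1 - x j) ≠ -i) :
    bilatTerm x y t = (∏ j, (Gamma (t + (1 - x j)) / Gamma (t + y j))) *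
      ∏ j, (sin (Real.pi * (x j - t)) / Real.pi) := by
  rw [bilatTerm, ← Finset.prod_mul_distrib]
  refine Finset.prod_congr rfl fun j _ => ?_
  have hG := Gamma_ne_zero (h j)
  have hr := Gamma_mul_Gamma_one_sub (x j - t)
  have e : 1 - (x j - t) = t + (1 - x j) := by ring
  rw [e] at hr
  have hpi : (Real.pi : ℂ) ≠ 0 := by exact_mod_cast Real.pi_ne_zero
  rw [add_comm (y j) t]
  by_cases hs : sin (Real.pi * (x j - t)) = 0
  · rw [hs, div_zero] at hr
    have : Gamma (x j - t) = 0 := (mul_eq_zero.mp hr).resolve_right hG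
    simp [this, hs]
  · have hx : Gamma (x j - t) ≠ 0 := by
      intro h0
      rw [h0, zero_mul] at hr
      exact (div_ne_zero hpi hs) hr.symm
    have : (Gamma (x j - t))⁻¹ = Gamma (t + (1 - x j)) * (sin (Real.pi * (x j - t)) / Real.pi) := by
      refine mul_left_cancel₀ hx ?_
      rw [mul_inv_cancel₀ hx, ← mul_assoc, hr, div_mul_div_cancel₀ hs, div_self hpi]
    rw [this]
    ring

/-- The size constant controlling the terms of the bilateral series. -/
def bilatConst (R : ℝ) : ℝ := Real.exp (12 * R ^ 2 * latticeBound) * Real.exp (4 * Real.pi * R)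

theorem norm_bilatTerm_le {x y : Fin 4 → ℂ} (hxy : ∑ j, x j + ∑ j, y j = 6) {R : ℝ}
    (hR : 1 ≤ R) (hx : ∀ j, ‖1 - x j‖ ≤ R) (hy : ∀ j, ‖y j‖ ≤ R) {t : ℂ}
    (ht : ∀ i : ℕ, 2 * R ≤ ‖t + i‖) {m : ℤ}
    (h : ∀ i : ℕ, ((m + i : ℤ) : ℝ) ^ 2 / 2 + 1 ≤ ‖t + i‖ ^ 2) :
    ‖bilatTerm x y t‖ ≤
      bilatConst R * Real.exp (4 * Real.pi * |t.im|) * (1 / ‖t‖ ^ 2) := by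
  rw [bilatTerm_eq, norm_mul]
  · have h1 := norm_prod_Gamma_ratio_le hxy hR hx hy ht h
    have h2 : ‖∏ j, (sin (Real.pi * (x j - t)) / Real.pi)‖ ≤
        Real.exp (4 * Real.pi * R) * Real.exp (4 * Real.pi * |t.im|) := by
      have h3 : ∀ j ∈ Finset.univ, ‖sin (Real.pi * (x j - t)) / Real.pi‖ ≤
          Real.exp (Real.pi * R + Real.pi * |t.im|) := by
        intro j _
        have hpi : ‖(Real.pi : ℂ)‖ = Real.pi := by
          simp [Real.pi_pos.le]
        rw [norm_div, hpi]
        have h4 : |((Real.pi : ℂ) * (x j - t)).im| ≤ Real.pi * R + Real.pi * |t.im| := by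
          have h5 : ((Real.pi : ℂ) * (x j - t)).im = Real.pi * ((x j).im - t.im) := by simp
          have h6 : |(x j).im| ≤ R := by
            have := (abs_im_le_norm (1 - x j)).trans (hx j)
            simpa using this
          rw [h5, abs_mul, abs_of_pos Real.pi_pos, ← mul_add]
          exact mul_le_mul_of_nonneg_left ((abs_sub _ _).trans (by linarith)) Real.pi_pos.le
        have h7 := (norm_sin_le_exp (Real.pi * (x j - t))).trans (Real.exp_le_exp.mpr h4)
        have h8 : (1 : ℝ) ≤ Real.pi := by linarith [Real.pi_gt_three]
        exact (div_le_self (norm_nonneg _) h8).trans h7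
      rw [norm_prod]
      refine (Finset.prod_le_prod (fun _ _ => norm_nonneg _) h3).trans (le_of_eq ?_)
      rw [Finset.prod_const, ← Real.exp_nat_mul, ← Real.exp_add]
      congr 1
      simp
      ring
    refine (mul_le_mul h1 h2 (norm_nonneg _) (by positivity)).trans (le_of_eq ?_)
    rw [bilatConst]
    ring
  · intro j i hji
    have h1 : t + i = -(1 - x j) := by linear_combination hji
    have h2 := ht i
    rw [h1, norm_neg] at h2
    linarith [hx j]

theorem bilatTerm_neg (x y : Fin 4 → ℂ) (t : ℂ) : bilatTerm x y (-t) = bilatTerm y x t := by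
  refine Finset.prod_congr rfl fun j _ => ?_
  rw [sub_neg_eq_add, ← sub_eq_add_neg, mul_comm]

theorem differentiable_bilatTerm_comp {X Y : ℂ → Fin 4 → ℂ} {T : ℂ → ℂ}
    (hX : ∀ j, Differentiable ℂ fun z => X z j)
    (hY : ∀ j, Differentiable ℂ fun z => Y z j) (hT : Differentiable ℂ T) :
    Differentiable ℂ fun z => bilatTerm (X z) (Y z) (T z) := by
  unfold bilatTerm
  refine Differentiable.fun_finsetProd fun j _ => ?_
  exact (differentiable_one_div_Gamma.comp ((hX j).sub hT)).mul
    (differentiable_one_div_Gamma.comp ((hY j).add hT))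

theorem bilatTerm_add (x y : Fin 4 → ℂ) (s t : ℂ) :
    bilatTerm x y (s + t) = bilatTerm (fun j => x j - s) (fun j => y j + s) t := by
  refine Finset.prod_congr rfl fun j _ => ?_
  rw [sub_sub, add_assoc]

theorem bilat_eq_shift (x y : Fin 4 → ℂ) (s : ℂ) :
    bilat x y s = ∑' k : ℤ, bilatTerm (fun j => x j - s) (fun j => y j + s) k := by
  simp only [bilat, bilatTerm_add]

theorem norm_bilatTerm_int_le {x y : Fin 4 → ℂ} (hxy : ∑ j, x j + ∑ j, y j = 6) {R : ℝ}
    (hR : 1 ≤ R) (hx : ∀ j, ‖x j‖ + 1 ≤ R) (hy : ∀ j, ‖y j‖ + 1 ≤ R) {k : ℤ}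
    (hk : 2 * R ≤ |(k : ℝ)|) :
    ‖bilatTerm x y k‖ ≤ bilatConst R * (1 / |(k : ℝ)| ^ 2) := by
  have pos : ∀ {x y : Fin 4 → ℂ}, ∑ j, x j + ∑ j, y j = 6 → (∀ j, ‖x j‖ + 1 ≤ R) →
      (∀ j, ‖y j‖ + 1 ≤ R) → ∀ {k : ℤ}, 0 ≤ k → 2 * R ≤ |(k : ℝ)| →
      ‖bilatTerm x y k‖ ≤ bilatConst R * (1 / |(k : ℝ)| ^ 2) := by
    intro x y hxy hx hy k hk0 hk
    have hk0' : (0 : ℝ) ≤ k := by exact_mod_cast hk0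
    have e : ∀ i : ℕ, ‖(k : ℂ) + i‖ = (k : ℝ) + i := by
      intro i
      have : (k : ℂ) + i = ((k + i : ℝ) : ℂ) := by push_cast; rfl
      rw [this, norm_real, Real.norm_of_nonneg (by positivity)]
    have hn : ‖(k : ℂ)‖ = |(k : ℝ)| := by simp
    rw [abs_of_nonneg hk0'] at hk
    have := norm_bilatTerm_le hxy hR (x := x) (y := y) (t := k) (m := k)
      (fun j => by
        have := norm_sub_le 1 (x j)
        rw [norm_one] at this
        linarith [hx j])
      (fun j => by linarith [hy j])
      (fun i => by
        rw [e]
        have : (0 : ℝ) ≤ i := Nat.cast_nonneg i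
        linarith)
      (fun i => by
        rw [e]
        have : (0 : ℝ) ≤ i := Nat.cast_nonneg i
        push_cast
        nlinarith)
    simpa [hn] using this
  rcases le_total 0 k with h0 | h0
  · exact pos hxy hx hy h0 hk
  · have e : (k : ℂ) = -((-k : ℤ) : ℂ) := by push_cast; ring
    rw [e, bilatTerm_neg]
    have := pos (x := y) (y := x) (by rw [add_comm]; exact hxy) hy hx (k := -k) (by omega)
      (by simpa using hk)
    simpa using this

open Filter in
theorem differentiable_tsum_bilatTerm {X Y : ℂ → Fin 4 → ℂ}
    (hX : ∀ j, Differentiable ℂ fun z => X z j) (hY : ∀ j, Differentiable ℂ fun z => Y z j)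
    (hsum : ∀ z, ∑ j, X z j + ∑ j, Y z j = 6) :
    Differentiable ℂ (fun z => ∑' k : ℤ, bilatTerm (X z) (Y z) k) ∧
      ∀ z, Summable fun k : ℤ => bilatTerm (X z) (Y z) k := by
  have main : ∀ r : ℝ, ∃ u : ℤ → ℝ, Summable u ∧
      ∀ k : ℤ, ∀ z ∈ Metric.ball (0 : ℂ) r, ‖bilatTerm (X z) (Y z) k‖ ≤ u k := by
    intro r
    have hc : ∀ f : ℂ → ℂ, Differentiable ℂ f →
        ∃ M, 0 ≤ M ∧ ∀ z ∈ Metric.ball (0 : ℂ) r, ‖f z‖ ≤ M := by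
      intro f hf
      obtain ⟨M, hM⟩ := (isCompact_closedBall (0 : ℂ) r).exists_bound_of_continuousOn
        hf.continuous.continuousOn
      exact ⟨max M 0, le_max_right _ _, fun z hz =>
        (hM z (Metric.ball_subset_closedBall hz)).trans (le_max_left _ _)⟩
    choose MX hX0 hMX using fun j => hc _ (hX j)
    choose MY hY0 hMY using fun j => hc _ (hY j)
    choose MT hT0 hMT using fun k : ℤ => hc _ (differentiable_bilatTerm_comp hX hY
      (differentiable_const (k : ℂ)))
    set R : ℝ := 1 + ∑ j, MX j + ∑ j, MY j with hRdef
    have hsX : ∀ j, MX j ≤ ∑ j, MX j := fun j =>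
      Finset.single_le_sum (fun i _ => hX0 i) (Finset.mem_univ j)
    have hsY : ∀ j, MY j ≤ ∑ j, MY j := fun j =>
      Finset.single_le_sum (fun i _ => hY0 i) (Finset.mem_univ j)
    have hR : 1 ≤ R := by linarith [hsX 0, hsY 0, hX0 0, hY0 0]
    have hlarge : ∀ᶠ k : ℤ in cofinite, 2 * R ≤ |(k : ℝ)| := by
      rw [Int.cofinite_eq]
      refine eventually_sup.mpr ⟨?_, ?_⟩
      · filter_upwards [eventually_le_atBot (-⌈2 * R⌉)] with k hk
        have h1 : (k : ℝ) ≤ -(⌈2 * R⌉ : ℝ) := by exact_mod_cast hk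
        have := neg_le_abs (k : ℝ)
        linarith [Int.le_ceil (2 * R)]
      · filter_upwards [eventually_ge_atTop (⌈2 * R⌉)] with k hk
        have h1 : (⌈2 * R⌉ : ℝ) ≤ k := by exact_mod_cast hk
        exact (Int.le_ceil _).trans (h1.trans (le_abs_self _))
    classical
    refine ⟨fun k => if 2 * R ≤ |(k : ℝ)| then bilatConst R * (1 / |(k : ℝ)| ^ 2) else MT k,
      ?_, ?_⟩
    · have hs : Summable fun k : ℤ => bilatConst R * (1 / |(k : ℝ)| ^ 2) := by
        simp only [sq_abs]
        exact (Real.summable_one_div_int_pow.mpr (by norm_num : 1 < 2)).mul_left _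
      refine Summable.of_norm_bounded_eventually hs ?_
      filter_upwards [hlarge] with k hk
      rw [if_pos hk, Real.norm_of_nonneg]
      have : 0 ≤ bilatConst R := by unfold bilatConst; positivity
      positivity
    · intro k z hz
      dsimp only
      split_ifs with hk
      · exact norm_bilatTerm_int_le (hsum z) hR
          (fun j => by linarith [hMX j z hz, hsX j, hsY 0, hY0 0])
          (fun j => by linarith [hMY j z hz, hsY j, hsX 0, hX0 0]) hk
      · exact hMT k z hz
  constructor
  · intro z
    obtain ⟨u, hu, hb⟩ := main (‖z‖ + 1)
    have := differentiableOn_tsum_of_summable_norm hu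
      (fun k => (differentiable_bilatTerm_comp hX hY
        (differentiable_const (k : ℂ))).differentiableOn) Metric.isOpen_ball hb
    exact this.differentiableAt (Metric.isOpen_ball.mem_nhds (by simp))
  · intro z
    obtain ⟨u, hu, hb⟩ := main (‖z‖ + 1)
    exact Summable.of_norm_bounded hu fun k => hb k z (by simp)

theorem differentiable_bilat_comp {X Y : ℂ → Fin 4 → ℂ} {T : ℂ → ℂ}
    (hX : ∀ j, Differentiable ℂ fun z => X z j) (hY : ∀ j, Differentiable ℂ fun z => Y z j)
    (hT : Differentiable ℂ T) (hsum : ∀ z, ∑ j, X z j + ∑ j, Y z j = 6) :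
    Differentiable ℂ fun z => bilat (X z) (Y z) (T z) := by
  simp only [bilat_eq_shift]
  refine (differentiable_tsum_bilatTerm (X := fun z j => X z j - T z)
    (Y := fun z j => Y z j + T z) (fun j => (hX j).sub hT) (fun j => (hY j).add hT) fun z => ?_).1
  rw [← hsum z]
  simp only [Finset.sum_sub_distrib, Finset.sum_add_distrib]
  ring

theorem summable_bilatTerm {x y : Fin 4 → ℂ} (hxy : ∑ j, x j + ∑ j, y j = 6) (s : ℂ) :
    Summable fun k : ℤ => bilatTerm x y (s + k) := by
  simp only [bilatTerm_add]
  refine (differentiable_tsum_bilatTerm (X := fun _ j => x j - s)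
    (Y := fun _ j => y j + s) (fun j => differentiable_const _)
    (fun j => differentiable_const _) fun z => ?_).2 0
  rw [← hxy]
  simp only [Finset.sum_sub_distrib, Finset.sum_add_distrib]
  ring

theorem bilat_add_one (x y : Fin 4 → ℂ) (s : ℂ) : bilat x y (s + 1) = bilat x y s := by
  unfold bilat
  rw [← (Equiv.addRight (1 : ℤ)).tsum_eq fun k : ℤ => bilatTerm x y (s + k)]
  refine tsum_congr fun k => ?_
  congr 1
  simp
  ring

/-- The decay factor of the bilateral series in the imaginary direction. -/
def bilatDecay (τ : ℝ) : ℝ := ∑' k : ℤ, min (1 / τ ^ 2) (1 / ((k : ℝ) ^ 2 / 2 + 1))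

open Filter Topology in
theorem tendsto_bilatDecay : Tendsto bilatDecay atTop (𝓝 0) := by
  have h : Tendsto (fun τ : ℝ => ∑' k : ℤ, min (1 / τ ^ 2) (1 / ((k : ℝ) ^ 2 / 2 + 1))) atTop
      (𝓝 (∑' _k : ℤ, (0 : ℝ))) := by
    refine tendsto_tsum_of_dominated_convergence summable_one_div_sq_half_add_one
      (fun k => ?_) (Eventually.of_forall fun τ k => ?_)
    · have h1 : Tendsto (fun τ : ℝ => 1 / τ ^ 2) atTop (𝓝 0) := by
        simp only [one_div]
        exact tendsto_inv_atTop_zero.comp (tendsto_pow_atTop (α := ℝ) (by norm_num : 2 ≠ 0))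
      refine squeeze_zero (fun τ => ?_) (fun τ => min_le_left _ _) h1
      positivity
    · rw [Real.norm_of_nonneg (by positivity)]
      exact min_le_right _ _
  rwa [tsum_zero] at h

theorem norm_bilat_le {x y : Fin 4 → ℂ} (hxy : ∑ j, x j + ∑ j, y j = 6) {R : ℝ}
    (hR : 1 ≤ R) (hx : ∀ j, ‖1 - x j‖ ≤ R) (hy : ∀ j, ‖y j‖ ≤ R) {s : ℂ} (hs : 2 * R ≤ |s.im|) :
    ‖bilat x y s‖ ≤ bilatConst R * Real.exp (4 * Real.pi * |s.im|) * bilatDecay |s.im| := by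
  wlog h0 : ⌊s.re⌋ = 0 generalizing s
  · have hper : Function.Periodic (bilat x y) 1 := bilat_add_one x y
    have := this (s := s - ⌊s.re⌋) (by simpa using hs) (by simp)
    rw [show bilat x y (s - ⌊s.re⌋) = bilat x y s by
      simpa using hper.sub_int_mul_eq (x := s) ⌊s.re⌋] at this
    simpa using this
  · obtain ⟨hf0, hf1⟩ := Int.floor_eq_iff.mp h0
    norm_num at hf0 hf1
    have hC : 0 ≤ bilatConst R := by unfold bilatConst; positivity
    have him : ∀ k : ℤ, ∀ i : ℕ, |s.im| ≤ ‖s + k + i‖ := fun k i => by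
      simpa using abs_im_le_norm (s + k + i)
    have hre : ∀ k : ℤ, ∀ i : ℕ, ((k + i : ℤ) : ℝ) ^ 2 / 2 + 1 ≤ ‖s + k + i‖ ^ 2 := by
      intro k i
      rw [← normSq_eq_norm_sq, normSq_apply]
      simp
      have : 2 ≤ |s.im| := by linarith
      have : 4 ≤ s.im * s.im := by
        rw [← abs_mul_abs_self]
        nlinarith
      nlinarith [sq_nonneg (s.re + k + i + s.re)]
    have hmin : Summable fun k : ℤ => min (1 / |s.im| ^ 2) (1 / ((k : ℝ) ^ 2 / 2 + 1)) :=
      Summable.of_nonneg_of_le (fun k => by positivity) (fun k => min_le_right _ _)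
        summable_one_div_sq_half_add_one
    refine tsum_of_norm_bounded (hmin.hasSum.mul_left _) fun k => ?_
    have h1 := norm_bilatTerm_le hxy hR hx hy (t := s + k) (m := k)
      (fun i => hs.trans (him k i)) (hre k)
    have h2 : (s + k).im = s.im := by simp
    rw [h2] at h1
    refine h1.trans (mul_le_mul_of_nonneg_left (le_min ?_ ?_) (by positivity))
    · have h3 := him k 0
      simp only [Nat.cast_zero, add_zero] at h3
      have : 0 < |s.im| := by linarith
      exact one_div_le_one_div_of_le (by positivity) (by gcongr)
    · have h3 := hre k 0
      simp only [Nat.cast_zero, add_zero] at h3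
      exact one_div_le_one_div_of_le (by positivity) h3

open Filter Topology in
theorem exists_polynomial_of_tendsto_div_pow (n : ℕ) : ∀ p : ℂ → ℂ, Differentiable ℂ p →
    Tendsto (fun q => p q / q ^ n) (cocompact ℂ) (𝓝 0) →
    ∃ c : ℕ → ℂ, ∀ q, p q = ∑ i ∈ Finset.range n, c i * q ^ i := by
  induction n with
  | zero =>
    intro p hp h
    refine ⟨0, fun q => ?_⟩
    simp only [pow_zero, div_one] at h
    simpa using hp.apply_eq_of_tendsto_cocompact q h
  | succ n ih =>
    intro p hp h
    have hd : Differentiable ℂ (dslope p 0) := by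
      rw [← differentiableOn_univ] at hp ⊢
      exact (differentiableOn_dslope univ_mem).mpr hp
    have hne : ∀ᶠ q : ℂ in cocompact ℂ, q ≠ 0 := by
      have := (isCompact_singleton (x := (0 : ℂ))).compl_mem_cocompact
      filter_upwards [this] with q hq using hq
    have hinv : Tendsto (fun q : ℂ => p 0 / q ^ (n + 1)) (cocompact ℂ) (𝓝 0) := by
      have h1 : Tendsto (fun q : ℂ => (q⁻¹) ^ (n + 1)) (cocompact ℂ) (𝓝 (0 ^ (n + 1))) :=
        (tendsto_inv₀_cobounded.mono_left (by rw [Metric.cobounded_eq_cocompact])).pow _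
      have h2 := h1.const_mul (p 0)
      simpa [div_eq_mul_inv] using h2
    obtain ⟨c, hc⟩ := ih _ hd (by
      have := h.sub hinv
      rw [sub_zero] at this
      refine this.congr' ?_
      filter_upwards [hne] with q hq
      rw [dslope_of_ne _ hq, slope_def_field, sub_zero, pow_succ]
      field_simp)
    refine ⟨fun i => if i = 0 then p 0 else c (i - 1), fun q => ?_⟩
    have h1 : p q = p 0 + q * dslope p 0 q := by
      have := sub_smul_dslope p 0 q
      rw [sub_zero, smul_eq_mul] at this
      rw [this]
      ring
    rw [h1, hc, Finset.sum_range_succ', Finset.mul_sum]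
    simp only [Nat.add_eq_zero_iff, one_ne_zero, and_false, if_false, if_true, pow_zero, mul_one,
      Nat.add_sub_cancel]
    rw [add_comm]
    congr 1
    refine Finset.sum_congr rfl fun i _ => ?_
    ring

open Filter Topology in
theorem bilat_eq_laurent {x y : Fin 4 → ℂ} (hxy : ∑ j, x j + ∑ j, y j = 6) :
    ∃ A B C : ℂ, ∀ s, bilat x y s =
      A * exp (-(2 * Real.pi * I * s)) + B + C * exp (2 * Real.pi * I * s) := by
  obtain ⟨R, hR, hx, hy⟩ : ∃ R : ℝ, 1 ≤ R ∧ (∀ j, ‖1 - x j‖ ≤ R) ∧ ∀ j, ‖y j‖ ≤ R := by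
    refine ⟨1 + ∑ j, ‖1 - x j‖ + ∑ j, ‖y j‖, ?_, fun j => ?_, fun j => ?_⟩
    · have h1 : 0 ≤ ∑ j, ‖1 - x j‖ := by positivity
      have h2 : 0 ≤ ∑ j, ‖y j‖ := by positivity
      linarith
    · have h1 := Finset.single_le_sum (fun i _ => norm_nonneg (1 - x i)) (Finset.mem_univ j)
      have h2 : 0 ≤ ∑ j, ‖y j‖ := by positivity
      linarith
    · have h1 := Finset.single_le_sum (fun i _ => norm_nonneg (y i)) (Finset.mem_univ j)
      have h2 : 0 ≤ ∑ j, ‖1 - x j‖ := by positivity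
      linarith
  set F : ℂ → ℂ := fun s => bilat x y s * Function.Periodic.qParam 1 s ^ 2 with hF
  have hb : ∀ s, 2 * R ≤ |s.im| →
      ‖bilat x y s‖ ≤ bilatConst R * Real.exp (4 * Real.pi * |s.im|) * bilatDecay |s.im| :=
    fun s hs => norm_bilat_le hxy hR hx hy hs
  have hdiff : Differentiable ℂ F := by
    refine Differentiable.mul ?_ ?_
    · exact differentiable_bilat_comp (X := fun _ => x) (Y := fun _ => y)
        (fun j => differentiable_const _) (fun j => differentiable_const _) differentiable_id
        fun _ => hxy
    · exact (Function.Periodic.differentiable_qParam).pow 2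
  have hper : Function.Periodic F (1 : ℝ) := by
    intro s
    have h1 : Function.Periodic.qParam 1 (s + (1 : ℝ)) = Function.Periodic.qParam 1 s := by
      simp [Function.Periodic.qParam, mul_add, exp_add]
    simp only [hF]
    rw [h1]
    rw [ofReal_one, bilat_add_one]
  have hqn : ∀ s, ‖Function.Periodic.qParam 1 s‖ = Real.exp (-2 * Real.pi * s.im) := fun s => by
    simpa using Function.Periodic.norm_qParam 1 s
  have hzero : (comap im atTop).ZeroAtFilter F := by
    have h1 : Tendsto (fun s : ℂ => bilatConst R * bilatDecay s.im) (comap im atTop) (𝓝 0) := by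
      simpa using (tendsto_bilatDecay.comp tendsto_comap).const_mul (bilatConst R)
    refine squeeze_zero_norm' ?_ h1
    have h2 : ∀ᶠ s : ℂ in comap im atTop, 2 * R ≤ s.im :=
      tendsto_comap.eventually (eventually_ge_atTop _)
    filter_upwards [h2] with s hs
    have habs : |s.im| = s.im := abs_of_nonneg (by linarith)
    have h3 := hb s (by rwa [habs])
    rw [habs] at h3
    simp only [hF]
    rw [norm_mul, norm_pow, hqn]
    calc _ ≤ bilatConst R * Real.exp (4 * Real.pi * s.im) * bilatDecay s.im *
          Real.exp (-2 * Real.pi * s.im) ^ 2 := by gcongr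
      _ = bilatConst R * bilatDecay s.im *
          (Real.exp (4 * Real.pi * s.im) * Real.exp (-2 * Real.pi * s.im) ^ 2) := by ring
      _ = _ := by
          rw [← Real.exp_nat_mul, ← Real.exp_add]
          ring_nf
          simp
  set p := Function.Periodic.cuspFunction 1 F with hp
  have hpF : ∀ s, p (Function.Periodic.qParam 1 s) = F s :=
    Function.Periodic.eq_cuspFunction one_ne_zero hper
  have hpd : Differentiable ℂ p := by
    intro q
    by_cases hq : q = 0
    · subst hq
      exact Function.Periodic.differentiableAt_cuspFunction_zero one_pos hper
        (Eventually.of_forall fun z => hdiff z) hzero.boundedAtFilter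
    · have := Function.Periodic.differentiableAt_cuspFunction one_ne_zero hper
        (hdiff (Function.Periodic.invQParam 1 q))
      rwa [Function.Periodic.qParam_right_inv one_ne_zero hq] at this
  have hp0 : p 0 = 0 := Function.Periodic.cuspFunction_zero_of_zero_at_inf one_pos hzero
  have hlim : Tendsto (fun q => p q / q ^ 4) (cocompact ℂ) (𝓝 0) := by
    have h1 : Tendsto (fun q : ℂ => Real.log ‖q‖ / (2 * Real.pi)) (cocompact ℂ) atTop :=
      (Real.tendsto_log_atTop.comp (tendsto_norm_cocompact_atTop (E := ℂ))).atTop_div_const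
        (by positivity)
    have h2 : Tendsto (fun q : ℂ => bilatConst R * bilatDecay (Real.log ‖q‖ / (2 * Real.pi)))
        (cocompact ℂ) (𝓝 0) := by
      simpa using (tendsto_bilatDecay.comp h1).const_mul (bilatConst R)
    refine squeeze_zero_norm' ?_ h2
    filter_upwards [h1.eventually (eventually_ge_atTop (2 * R)),
      (tendsto_norm_cocompact_atTop (E := ℂ)).eventually (eventually_gt_atTop 0)] with q hq hq0
    have hqne : q ≠ 0 := norm_pos_iff.mp hq0
    set s := Function.Periodic.invQParam 1 q with hs
    have him : s.im = -(Real.log ‖q‖ / (2 * Real.pi)) := by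
      rw [hs, Function.Periodic.im_invQParam]
      ring
    have habs : |s.im| = Real.log ‖q‖ / (2 * Real.pi) := by
      rw [him, abs_neg, abs_of_nonneg (by linarith)]
    have hqs : Function.Periodic.qParam 1 s = q :=
      Function.Periodic.qParam_right_inv one_ne_zero hqne
    have h3 := hb s (by rwa [habs])
    have hexp : Real.exp (4 * Real.pi * |s.im|) = ‖q‖ ^ 2 := by
      rw [habs]
      have : 4 * Real.pi * (Real.log ‖q‖ / (2 * Real.pi)) = (2 : ℕ) * Real.log ‖q‖ := by
        field_simp
        push_cast
        ring
      rw [this, Real.exp_nat_mul, Real.exp_log hq0]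
    rw [hexp, habs] at h3
    rw [← hqs, hpF, hqs]
    simp only [hF]
    rw [hqs, norm_div, norm_mul, norm_pow, norm_pow, div_le_iff₀ (by positivity)]
    calc _ ≤ bilatConst R * ‖q‖ ^ 2 * bilatDecay (Real.log ‖q‖ / (2 * Real.pi)) * ‖q‖ ^ 2 := by
          gcongr
      _ = _ := by ring
  obtain ⟨c, hc⟩ := exists_polynomial_of_tendsto_div_pow 4 p hpd hlim
  have hc0 : c 0 = 0 := by
    have := hc 0
    rw [hp0] at this
    simpa [Finset.sum_range_succ] using this.symm
  refine ⟨c 1, c 2, c 3, fun s => ?_⟩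
  have h1 := hpF s
  rw [hc] at h1
  simp only [Finset.sum_range_succ, Finset.sum_range_zero, hc0, hF] at h1
  have hq : Function.Periodic.qParam 1 s = exp (2 * Real.pi * I * s) := by
    simp [Function.Periodic.qParam]
  rw [hq] at h1
  rw [exp_neg]
  have hne := exp_ne_zero (2 * Real.pi * I * s)
  field_simp
  refine mul_right_cancel₀ hne ?_
  linear_combination -h1

theorem Sn_nat_add (a : ℂ) (k : ℕ) : Sn (k + a) = (-1) ^ k * Sn a := by
  induction k with
  | zero => simp
  | succ k ih =>
    rw [pow_succ, mul_right_comm, ← ih]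
    simp only [Sn]
    rw [mul_neg_one, ← sin_add_pi]
    congr 1
    push_cast
    ring

theorem inv_Gamma_one_sub (a : ℂ) (ha : Sn a ≠ 0) :
    (Gamma (1 - a))⁻¹ = Gamma a * Sn a / Real.pi := by
  have h := Gamma_mul_Gamma_one_sub a
  have hpi : (Real.pi : ℂ) ≠ 0 := by exact_mod_cast Real.pi_ne_zero
  have h0 : Gamma (1 - a) ≠ 0 := by
    intro h0
    rw [h0, mul_zero] at h
    exact div_ne_zero hpi ha h.symm
  have ha' : sin (Real.pi * a) ≠ 0 := ha
  rw [eq_div_iff ha'] at h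
  rw [inv_eq_iff_eq_inv, inv_div, eq_div_iff (by
    refine mul_ne_zero ?_ ha
    rintro h1
    rw [h1, zero_mul, zero_mul] at h
    exact hpi h.symm), ← h, Sn]
  ring

theorem inv_Gamma_one_sub_nat_add (a : ℂ) (k : ℕ) (ha : Sn a ≠ 0) :
    (Gamma (1 - a - k))⁻¹ = (-1) ^ k * (Gamma (k + a) * Sn a / Real.pi) := by
  have h := inv_Gamma_one_sub (k + a) (by rw [Sn_nat_add]; simp [ha])
  rw [show 1 - a - k = 1 - (k + a) by ring, h, Sn_nat_add]
  ring

/-- The bilateral form of `Fstar`. -/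
def bilatF (a b c d e f g s : ℂ) : ℂ := bilat ![1 - a, 1 - b, 1 - c, 1 - d] ![1, e, f, g] s

theorem bilatTerm_four (a b c d e f g h t : ℂ) : bilatTerm ![a, b, c, d] ![e, f, g, h] t =
    ((Gamma (a - t))⁻¹ * (Gamma (b - t))⁻¹ * (Gamma (c - t))⁻¹ * (Gamma (d - t))⁻¹) *
    ((Gamma (e + t))⁻¹ * (Gamma (f + t))⁻¹ * (Gamma (g + t))⁻¹ * (Gamma (h + t))⁻¹) := by
  simp only [bilatTerm, Fin.prod_univ_four]
  simp only [Matrix.cons_val]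
  ring

theorem bilat_neg (x y : Fin 4 → ℂ) (s : ℂ) : bilat x y (-s) = bilat y x s := by
  unfold bilat
  rw [← (Equiv.neg ℤ).tsum_eq]
  refine tsum_congr fun k => ?_
  rw [← bilatTerm_neg, Equiv.neg_apply]
  push_cast
  congr 1
  ring

theorem bilat_add_left (x y : Fin 4 → ℂ) (s t : ℂ) :
    bilat x y (s + t) = bilat (fun j => x j - s) (fun j => y j + s) t := by
  simp only [bilat, add_assoc, bilatTerm_add]

theorem bilatTerm_zero_add_nat {a b c d : ℂ} (e f g : ℂ) (ha : Sn a ≠ 0) (hb : Sn b ≠ 0)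
    (hc : Sn c ≠ 0) (hd : Sn d ≠ 0) (k : ℕ) :
    (Gamma (k + a) * Gamma (k + b) * Gamma (k + c) * Gamma (k + d)) /
      (k.factorial * Gamma (k + e) * Gamma (k + f) * Gamma (k + g)) * (Sn a * Sn b * Sn c * Sn d) =
      Real.pi ^ 4 * bilatTerm ![1 - a, 1 - b, 1 - c, 1 - d] ![1, e, f, g] (0 + ((k : ℤ) : ℂ)) := by
  have hpi : (Real.pi : ℂ) ≠ 0 := by exact_mod_cast Real.pi_ne_zero
  rw [bilatTerm_four]
  simp only [zero_add, Int.cast_natCast, inv_Gamma_one_sub_nat_add _ k ha,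
    inv_Gamma_one_sub_nat_add _ k hb, inv_Gamma_one_sub_nat_add _ k hc,
    inv_Gamma_one_sub_nat_add _ k hd]
  rw [add_comm 1, Gamma_nat_eq_factorial, add_comm e, add_comm f, add_comm g]
  have h1 : ((-1 : ℂ) ^ k) ^ 4 = 1 := by rw [← pow_mul, mul_comm, pow_mul]; norm_num
  simp only [div_eq_mul_inv, mul_inv]
  have h2 : (Real.pi : ℂ) ^ 4 * (Real.pi : ℂ)⁻¹ ^ 4 = 1 := by
    field_simp
  linear_combination -(Gamma (k + a) * Gamma (k + b) * Gamma (k + c) * Gamma (k + d) *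
    ((k.factorial : ℂ)⁻¹ * (Gamma (k + e))⁻¹ * (Gamma (k + f))⁻¹ * (Gamma (k + g))⁻¹) *
    (Sn a * Sn b * Sn c * Sn d)) * (h1 + ((-1 : ℂ) ^ k) ^ 4 * h2)

theorem Fstar_eq_bilatF (a b c d e f g : ℂ) (ha : Sn a ≠ 0) (hb : Sn b ≠ 0) (hc : Sn c ≠ 0)
    (hd : Sn d ≠ 0) :
    Fstar a b c d e f g * (Sn a * Sn b * Sn c * Sn d) = Real.pi ^ 4 * bilatF a b c d e f g 0 := by
  have hpi : (Real.pi : ℂ) ≠ 0 := by exact_mod_cast Real.pi_ne_zero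
  have hsupp : Function.support (fun k : ℤ =>
      bilatTerm ![1 - a, 1 - b, 1 - c, 1 - d] ![1, e, f, g] (0 + k)) ⊆
      Set.range ((↑) : ℕ → ℤ) := by
    intro k hk
    by_contra hr
    apply hk
    have hneg : k < 0 := by
      by_contra h
      exact hr ⟨k.toNat, by simp only [Int.toNat_of_nonneg (not_lt.mp h)]⟩
    have : Gamma (1 + (0 + (k : ℂ))) = 0 := by
      rw [Gamma_eq_zero_iff]
      refine ⟨(-(1 + k)).toNat, ?_⟩
      have : (((-(1 + k)).toNat : ℤ) : ℂ) = ((-(1 + k) : ℤ) : ℂ) := by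
        rw [Int.toNat_of_nonneg (by omega)]
      rw [Int.cast_natCast] at this
      rw [this]
      push_cast
      ring
    simp only [bilatTerm_four, this, inv_zero, zero_mul, mul_zero]
  rw [bilatF, bilat, ← (Nat.cast_injective (R := ℤ)).tsum_eq hsupp, Fstar, ← tsum_mul_left,
    ← tsum_mul_right]
  refine tsum_congr fun k => ?_
  exact bilatTerm_zero_add_nat e f g ha hb hc hd k

theorem Fstar_eq_bilatF_neg (a b c d e f g : ℂ) (ha : Sn a ≠ 0) (hb : Sn (1 + a - e) ≠ 0)
    (hc : Sn (1 + a - f) ≠ 0) (hd : Sn (1 + a - g) ≠ 0) :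
    Fstar a (1 + a - e) (1 + a - f) (1 + a - g) (1 + a - b) (1 + a - c) (1 + a - d) *
      (Sn a * Sn (1 + a - e) * Sn (1 + a - f) * Sn (1 + a - g)) =
      Real.pi ^ 4 * bilatF a b c d e f g (-a) := by
  rw [Fstar_eq_bilatF _ _ _ _ _ _ _ ha hb hc hd]
  congr 1
  rw [bilatF, bilatF, bilat_neg, ← add_zero a, bilat_add_left]
  unfold bilat
  refine tsum_congr fun k => ?_
  have e1 : (fun j => ![1, e, f, g] j - a) = ![1 - a, e - a, f - a, g - a] := by
    ext j; fin_cases j <;> rfl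
  have e2 : (fun j => ![1 - (a + 0), 1 - b, 1 - c, 1 - d] j + a) =
      ![1, 1 - b + a, 1 - c + a, 1 - d + a] := by
    ext j; fin_cases j <;> simp
  rw [e1, e2]
  congr 1
  · ext j; fin_cases j <;> simp <;> ring
  · ext j; fin_cases j <;> simp <;> ring

open MeasureTheory Set ENNReal in
/-- Change of variables along a differentiable bijection with a given inverse. -/
theorem lintegral_subst {s t : Set ℝ} {φ φ' ψ : ℝ → ℝ} (hs : MeasurableSet s)
    (hφ : ∀ x ∈ s, φ x ∈ t) (hψ : ∀ y ∈ t, ψ y ∈ s) (hφψ : ∀ y ∈ t, φ (ψ y) = y)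
    (hψφ : ∀ x ∈ s, ψ (φ x) = x) (hd : ∀ x ∈ s, HasDerivAt φ (φ' x) x) (g : ℝ → ℝ≥0∞) :
    ∫⁻ y in t, g y = ∫⁻ x in s, ENNReal.ofReal |φ' x| * g (φ x) := by
  have ht : φ '' s = t := by
    ext y
    constructor
    · rintro ⟨x, hx, rfl⟩
      exact hφ x hx
    · intro hy
      exact ⟨ψ y, hψ y hy, hφψ y hy⟩
  rw [← ht]
  refine lintegral_image_eq_lintegral_abs_deriv_mul hs (fun x hx => (hd x hx).hasDerivWithinAt) ?_ g
  intro x hx y hy hxy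
  rw [← hψφ x hx, ← hψφ y hy, hxy]

open MeasureTheory Set ENNReal in
theorem lintegral_swap_region {A C : Set ℝ} {B D : ℝ → Set ℝ} (hA : MeasurableSet A)
    (hC : MeasurableSet C) (hB : ∀ x, MeasurableSet (B x)) (hD : ∀ y, MeasurableSet (D y))
    (h : ∀ x y, x ∈ A ∧ y ∈ B x ↔ y ∈ C ∧ x ∈ D y)
    (hS : MeasurableSet {p : ℝ × ℝ | p.1 ∈ A ∧ p.2 ∈ B p.1}) {f : ℝ → ℝ → ℝ≥0∞}
    (hf : Measurable (Function.uncurry f)) :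
    ∫⁻ x in A, ∫⁻ y in B x, f x y = ∫⁻ y in C, ∫⁻ x in D y, f x y := by
  classical
  have e1 : ∫⁻ x in A, ∫⁻ y in B x, f x y =
      ∫⁻ x, ∫⁻ y, {p : ℝ × ℝ | p.1 ∈ A ∧ p.2 ∈ B p.1}.indicator (Function.uncurry f) (x, y) := by
    rw [← lintegral_indicator hA]
    refine lintegral_congr fun x => ?_
    by_cases hx : x ∈ A
    · rw [indicator_of_mem hx, ← lintegral_indicator (hB x)]
      refine lintegral_congr fun y => ?_
      simp [indicator, hx]
    · rw [indicator_of_notMem hx]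
      simp [indicator, hx]
  have e2 : ∫⁻ y in C, ∫⁻ x in D y, f x y =
      ∫⁻ y, ∫⁻ x, {p : ℝ × ℝ | p.1 ∈ A ∧ p.2 ∈ B p.1}.indicator (Function.uncurry f) (x, y) := by
    rw [← lintegral_indicator hC]
    refine lintegral_congr fun y => ?_
    by_cases hy : y ∈ C
    · rw [indicator_of_mem hy, ← lintegral_indicator (hD y)]
      refine lintegral_congr fun x => ?_
      simp [indicator, h, hy]
    · rw [indicator_of_notMem hy]
      simp [indicator, h, hy]
  rw [e1, e2]
  exact lintegral_lintegral_swap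
    (f := fun x y => {p : ℝ × ℝ | p.1 ∈ A ∧ p.2 ∈ B p.1}.indicator (Function.uncurry f) (x, y))
    (hf.indicator hS).aemeasurable

open MeasureTheory Set in
theorem lintegral_rpow_mul_exp_neg_mul {s r : ℝ} (hs : 0 < s) (hr : 0 < r) :
    ∫⁻ t in Ioi (0 : ℝ), ENNReal.ofReal (t ^ (s - 1) * Real.exp (-(r * t))) =
      ENNReal.ofReal (r ^ (-s) * Real.Gamma s) := by
  have h := Real.integral_rpow_mul_exp_neg_mul_Ioi hs hr
  have hpos : 0 < (1 / r) ^ s * Real.Gamma s := mul_pos (by positivity) (Real.Gamma_pos_of_pos hs)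
  rw [← ofReal_integral_eq_lintegral_ofReal, h, Real.rpow_neg hr.le, one_div, Real.inv_rpow hr.le]
  · by_contra hi
    rw [integral_undef hi] at h
    exact hpos.ne h
  · refine (ae_restrict_iff' measurableSet_Ioi).2 (Filter.Eventually.of_forall fun x hx => ?_)
    have : 0 < x := hx
    simp only [Pi.zero_apply]
    positivity

open MeasureTheory Set in
theorem lintegral_beta {p q : ℝ} (hp : 0 < p) (hq : 0 < q) :
    ∫⁻ x in Ioo (0 : ℝ) 1, ENNReal.ofReal (x ^ (p - 1) * (1 - x) ^ (q - 1)) =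
      ENNReal.ofReal (Real.Gamma p * Real.Gamma q / Real.Gamma (p + q)) := by
  have h := ProbabilityTheory.lintegral_betaPDF_eq_one hp hq
  have hb := ProbabilityTheory.beta_pos hp hq
  rw [ProbabilityTheory.lintegral_betaPDF] at h
  simp_rw [mul_assoc] at h
  simp_rw [ENNReal.ofReal_mul (one_div_pos.2 hb).le] at h
  rw [lintegral_const_mul' _ _ ENNReal.ofReal_ne_top] at h
  have h2 : ENNReal.ofReal (ProbabilityTheory.beta p q) *
      ENNReal.ofReal (1 / ProbabilityTheory.beta p q) = 1 := by
    rw [← ENNReal.ofReal_mul hb.le, mul_one_div_cancel hb.ne', ENNReal.ofReal_one]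
  calc _ = ENNReal.ofReal (ProbabilityTheory.beta p q) *
          (ENNReal.ofReal (1 / ProbabilityTheory.beta p q) *
    ∫⁻ x in Ioo (0 : ℝ) 1, ENNReal.ofReal (x ^ (p - 1) * (1 - x) ^ (q - 1))) := by
        rw [← mul_assoc, h2, one_mul]
    _ = _ := by rw [h, mul_one]; rfl

open MeasureTheory Set in
theorem lintegral_beta_Ioi_one {p q : ℝ} (hp : 0 < p) (hq : 0 < q) :
    ∫⁻ x in Ioi (1 : ℝ), ENNReal.ofReal (x ^ (-p - q) * (x - 1) ^ (q - 1)) =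
      ENNReal.ofReal (Real.Gamma p * Real.Gamma q / Real.Gamma (p + q)) := by
  rw [← lintegral_beta hp hq, lintegral_subst (s := Ioo 0 1) (φ := fun x => x⁻¹)
    (φ' := fun x => -(x ^ 2)⁻¹) (ψ := fun x => x⁻¹) measurableSet_Ioo]
  · refine setLIntegral_congr_fun measurableSet_Ioo fun x hx => ?_
    have h0 : 0 < x := hx.1
    have h1 : 0 < 1 - x := by linarith [hx.2]
    rw [abs_neg, abs_of_pos (by positivity), ← ENNReal.ofReal_mul (by positivity)]
    congr 1
    have h2 : x⁻¹ - 1 = (1 - x) * x⁻¹ := by field_simp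
    rw [h2, Real.mul_rpow h1.le (by positivity), Real.inv_rpow h0.le, Real.inv_rpow h0.le,
      ← Real.rpow_neg h0.le, ← Real.rpow_neg h0.le, ← Real.rpow_natCast, ← Real.rpow_neg h0.le]
    rw [show p - 1 = -((2 : ℕ) : ℝ) + -(-p - q) + -(q - 1) by push_cast; ring,
      Real.rpow_add h0, Real.rpow_add h0]
    ring
  · intro x hx
    exact (one_lt_inv₀ hx.1).2 hx.2
  · intro y hy
    exact ⟨inv_pos.2 (one_pos.trans hy), inv_lt_one_of_one_lt₀ hy⟩
  · simp
  · simp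
  · intro x hx
    exact hasDerivAt_inv hx.1.ne'

open MeasureTheory Set in
theorem lintegral_rpow_mul_add_rpow {B C p q : ℝ} (hB : 0 < B) (hC : B < C) (hp : 0 < p)
    (hq : 0 < q) :
    ∫⁻ R in Ioi (0 : ℝ), ENNReal.ofReal (R ^ (B - 1) * (p + q * R) ^ (-C)) =
      ENNReal.ofReal (p ^ (B - C) * q ^ (-B) *
        (Real.Gamma B * Real.Gamma (C - B) / Real.Gamma C)) := by
  have hb := lintegral_beta hB (sub_pos.2 hC)
  rw [add_sub_cancel] at hb
  rw [ENNReal.ofReal_mul (by positivity), ← hb, ← lintegral_const_mul' _ _ ENNReal.ofReal_ne_top]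
  rw [lintegral_subst (s := Ioo 0 1) (φ := fun x => p / q * (x / (1 - x)))
    (φ' := fun x => p / q * (1 / (1 - x) ^ 2)) (ψ := fun R => q * R / (p + q * R))
    measurableSet_Ioo]
  · refine setLIntegral_congr_fun measurableSet_Ioo fun x hx => ?_
    have h0 : 0 < x := hx.1
    have h1 : 0 < 1 - x := by linarith [hx.2]
    rw [abs_of_pos (by positivity), ← ENNReal.ofReal_mul (by positivity),
      ← ENNReal.ofReal_mul (by positivity)]
    congr 1
    have h2 : p + q * (p / q * (x / (1 - x))) = p / (1 - x) := by field_simp; ring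
    have h3 : p / q * (1 / (1 - x) ^ 2) =
        Real.exp (Real.log p - Real.log q - 2 * Real.log (1 - x)) := by
      rw [Real.exp_sub, Real.exp_sub, Real.exp_log hp, Real.exp_log hq, two_mul, Real.exp_add,
        Real.exp_log h1]
      field_simp
    rw [h2, h3]
    simp only [Real.rpow_def_of_pos h0, Real.rpow_def_of_pos h1, Real.rpow_def_of_pos hp,
      Real.rpow_def_of_pos hq, Real.rpow_def_of_pos (show 0 < p / q * (x / (1 - x)) by positivity),
      Real.rpow_def_of_pos (show 0 < p / (1 - x) by positivity), ← Real.exp_add]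
    rw [Real.log_mul (by positivity) (by positivity), Real.log_div hp.ne' hq.ne',
      Real.log_div h0.ne' h1.ne', Real.log_div hp.ne' h1.ne']
    congr 1
    ring
  · intro x hx
    have h0 : 0 < x := hx.1
    have h1 : 0 < 1 - x := by linarith [hx.2]
    simp only [mem_Ioi]
    positivity
  · intro R hR
    have h0 : 0 < R := hR
    refine ⟨by positivity, ?_⟩
    rw [div_lt_one (by positivity)]
    linarith
  · intro R hR
    have h0 : 0 < R := hR
    have : 1 - q * R / (p + q * R) = p / (p + q * R) := by field_simp; ring
    simp only [this]
    field_simp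
  · intro x hx
    have h0 : 0 < x := hx.1
    have h1 : 0 < 1 - x := by linarith [hx.2]
    have h2 : p + q * (p / q * (x / (1 - x))) = p / (1 - x) := by field_simp; ring
    simp only [h2]
    field_simp
  · intro x hx
    have h1 : (1 - x) ≠ 0 := by linarith [hx.2]
    have := ((hasDerivAt_id x).div ((hasDerivAt_const x (1 : ℝ)).sub
      (hasDerivAt_id x)) h1).const_mul (p / q)
    convert! this using 1
    simp

open MeasureTheory Set in
theorem ofReal_Gamma_mul_one_sub_rpow {a y : ℝ} (ha : 0 < a) (hy : 0 < y) (hy1 : y < 1) :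
    ENNReal.ofReal (Real.Gamma a * (1 - y) ^ (-a)) =
      ∑' k : ℕ, ENNReal.ofReal (Real.Gamma (a + k) / k.factorial * y ^ k) := by
  have h1 : 0 < 1 - y := by linarith
  rw [mul_comm (Real.Gamma a), ← lintegral_rpow_mul_exp_neg_mul ha h1]
  have e : ∀ k : ℕ, ENNReal.ofReal (Real.Gamma (a + k) / k.factorial * y ^ k) =
      ∫⁻ t in Ioi (0 : ℝ), ENNReal.ofReal
        (y ^ k / k.factorial * (t ^ (a + k - 1) * Real.exp (-(1 * t)))) := by
    intro k
    have := lintegral_rpow_mul_exp_neg_mul (s := a + k) (r := 1) (by positivity) one_pos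
    simp_rw [ENNReal.ofReal_mul (show 0 ≤ y ^ k / k.factorial by positivity)]
    rw [lintegral_const_mul' _ _ ENNReal.ofReal_ne_top, this, ← ENNReal.ofReal_mul (by positivity)]
    congr 1
    rw [Real.one_rpow]
    ring
  simp_rw [e]
  rw [← lintegral_tsum fun k => by fun_prop]
  refine setLIntegral_congr_fun measurableSet_Ioi fun t ht => ?_
  have ht : 0 < t := ht
  have hs := (NormedSpace.expSeries_div_hasSum_exp (t * y)).mul_left
    (t ^ (a - 1) * Real.exp (-(1 * t)))
  have hs' : HasSum (fun k : ℕ => y ^ k / k.factorial * (t ^ (a + k - 1) * Real.exp (-(1 * t))))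
      (t ^ (a - 1) * Real.exp (-((1 - y) * t))) := by
    convert! hs using 1
    · ext k
      rw [show a + k - 1 = a - 1 + k by ring, Real.rpow_add_natCast ht.ne']
      ring
    · rw [← Real.exp_eq_exp_ℝ, mul_assoc, ← Real.exp_add]
      congr 2
      ring
  rw [← hs'.tsum_eq, ENNReal.ofReal_tsum_of_nonneg (fun k => by positivity) hs'.summable]

open MeasureTheory Set ENNReal in
theorem lintegral_three_tsum (s : Set ℝ) (c : ℕ → ℝ≥0∞) (f₁ f₂ f₃ : ℕ → ℝ → ℝ≥0∞)
    (h₁ : ∀ k, Measurable (f₁ k)) (h₂ : ∀ k, Measurable (f₂ k)) (h₃ : ∀ k, Measurable (f₃ k)) :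
    ∫⁻ z in s, ∫⁻ y in s, ∫⁻ x in s, ∑' k, c k * (f₁ k x * (f₂ k y * f₃ k z)) =
      ∑' k, c k * ((∫⁻ x in s, f₁ k x) * ((∫⁻ y in s, f₂ k y) * ∫⁻ z in s, f₃ k z)) := by
  have e1 : ∀ z y, ∫⁻ x in s, ∑' k, c k * (f₁ k x * (f₂ k y * f₃ k z)) =
      ∑' k, c k * ((∫⁻ x in s, f₁ k x) * (f₂ k y * f₃ k z)) := by
    intro z y
    rw [lintegral_tsum fun k => by fun_prop]
    refine tsum_congr fun k => ?_
    rw [lintegral_const_mul _ (by fun_prop), lintegral_mul_const _ (by fun_prop)]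
  have e2 : ∀ z, ∫⁻ y in s, ∑' k, c k * ((∫⁻ x in s, f₁ k x) * (f₂ k y * f₃ k z)) =
      ∑' k, c k * ((∫⁻ x in s, f₁ k x) * ((∫⁻ y in s, f₂ k y) * f₃ k z)) := by
    intro z
    rw [lintegral_tsum fun k => by fun_prop]
    refine tsum_congr fun k => ?_
    rw [lintegral_const_mul _ (by fun_prop), lintegral_const_mul _ (by fun_prop),
      lintegral_mul_const _ (by fun_prop)]
  simp_rw [e1, e2]
  rw [lintegral_tsum fun k => by fun_prop]
  refine tsum_congr fun k => ?_
  rw [lintegral_const_mul _ (by fun_prop), lintegral_const_mul _ (by fun_prop),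
    lintegral_const_mul _ (by fun_prop)]

/-- The integrand of the triple Euler integral for `₄F₃(1)`. -/
def eulerFn (a b₁ b₂ b₃ d₁ d₂ d₃ x y z : ℝ) : ℝ :=
  x ^ (b₁ - 1) * |1 - x| ^ (d₁ - 1) * (y ^ (b₂ - 1) * |1 - y| ^ (d₂ - 1)) *
    (z ^ (b₃ - 1) * |1 - z| ^ (d₃ - 1)) * |1 - x * y * z| ^ (-a)

theorem measurable_eulerFn (a b₁ b₂ b₃ d₁ d₂ d₃ : ℝ) {α : Type*} [MeasurableSpace α]
    {x y z : α → ℝ} (hx : Measurable x) (hy : Measurable y) (hz : Measurable z) :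
    Measurable fun t => eulerFn a b₁ b₂ b₃ d₁ d₂ d₃ (x t) (y t) (z t) := by
  unfold eulerFn
  fun_prop

/-- The terms of the nonterminating `₄F₃` with beta-function weights. -/
def eulerCoeff (a b₁ b₂ b₃ d₁ d₂ d₃ : ℝ) (k : ℕ) : ℝ :=
  Real.Gamma (a + k) / k.factorial *
    (Real.Gamma (b₁ + k) * Real.Gamma d₁ / Real.Gamma (b₁ + k + d₁) *
    (Real.Gamma (b₂ + k) * Real.Gamma d₂ / Real.Gamma (b₂ + k + d₂) *
    (Real.Gamma (b₃ + k) * Real.Gamma d₃ / Real.Gamma (b₃ + k + d₃))))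

open MeasureTheory Set in
theorem lintegral_eulerFn_unit {a b₁ b₂ b₃ d₁ d₂ d₃ : ℝ} (ha : 0 < a) (hb₁ : 0 < b₁) (hb₂ : 0 < b₂)
    (hb₃ : 0 < b₃) (hd₁ : 0 < d₁) (hd₂ : 0 < d₂) (hd₃ : 0 < d₃) :
    ∫⁻ z in Ioo (0 : ℝ) 1, ∫⁻ y in Ioo (0 : ℝ) 1, ∫⁻ x in Ioo (0 : ℝ) 1,
      ENNReal.ofReal (Real.Gamma a * eulerFn a b₁ b₂ b₃ d₁ d₂ d₃ x y z) =
      ∑' k : ℕ, ENNReal.ofReal (eulerCoeff a b₁ b₂ b₃ d₁ d₂ d₃ k) := by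
  have key := lintegral_three_tsum (Ioo (0 : ℝ) 1)
    (fun k => ENNReal.ofReal (Real.Gamma (a + k) / k.factorial))
    (fun k x => ENNReal.ofReal (x ^ (b₁ + k - 1) * (1 - x) ^ (d₁ - 1)))
    (fun k x => ENNReal.ofReal (x ^ (b₂ + k - 1) * (1 - x) ^ (d₂ - 1)))
    (fun k x => ENNReal.ofReal (x ^ (b₃ + k - 1) * (1 - x) ^ (d₃ - 1)))
    (fun k => by fun_prop) (fun k => by fun_prop) (fun k => by fun_prop)
  have hG : ∀ {u : ℝ}, 0 < u → 0 < Real.Gamma u := Real.Gamma_pos_of_pos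
  have hk : ∀ (k : ℕ) {u : ℝ}, 0 < u → 0 < u + k := fun k u hu => by positivity
  have hR : ∀ k : ℕ, ENNReal.ofReal (eulerCoeff a b₁ b₂ b₃ d₁ d₂ d₃ k) =
      ENNReal.ofReal (Real.Gamma (a + k) / k.factorial) *
      ((∫⁻ x in Ioo (0 : ℝ) 1, ENNReal.ofReal (x ^ (b₁ + k - 1) * (1 - x) ^ (d₁ - 1))) *
      ((∫⁻ x in Ioo (0 : ℝ) 1, ENNReal.ofReal (x ^ (b₂ + k - 1) * (1 - x) ^ (d₂ - 1))) *
      ∫⁻ x in Ioo (0 : ℝ) 1, ENNReal.ofReal (x ^ (b₃ + k - 1) * (1 - x) ^ (d₃ - 1)))) := by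
    intro k
    have g1 := hG (hk k hb₁)
    have g2 := hG (hk k hb₂)
    have g3 := hG (hk k hb₃)
    have g4 := hG (hk k ha)
    have g5 := hG hd₁
    have g6 := hG hd₂
    have g7 := hG hd₃
    have g8 := hG (add_pos (hk k hb₁) hd₁)
    have g9 := hG (add_pos (hk k hb₂) hd₂)
    rw [lintegral_beta (hk k hb₁) hd₁, lintegral_beta (hk k hb₂) hd₂, lintegral_beta (hk k hb₃) hd₃,
      ← ENNReal.ofReal_mul (by positivity), ← ENNReal.ofReal_mul (by positivity),
      ← ENNReal.ofReal_mul (by positivity)]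
    rfl
  simp_rw [hR]
  rw [← key]
  refine setLIntegral_congr_fun measurableSet_Ioo fun z hz => ?_
  refine setLIntegral_congr_fun measurableSet_Ioo fun y hy => ?_
  refine setLIntegral_congr_fun measurableSet_Ioo fun x hx => ?_
  obtain ⟨hx0, hx1⟩ := hx
  obtain ⟨hy0, hy1⟩ := hy
  obtain ⟨hz0, hz1⟩ := hz
  have hx1' := sub_pos.2 hx1
  have hy1' := sub_pos.2 hy1
  have hz1' := sub_pos.2 hz1
  have hxyz : x * y * z < 1 := by
    have : x * y < 1 := mul_lt_one_of_nonneg_of_lt_one_left hx0.le hx1 hy1.le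
    exact mul_lt_one_of_nonneg_of_lt_one_left (by positivity) this hz1.le
  have hxyz' := sub_pos.2 hxyz
  simp only [eulerFn]
  rw [abs_of_pos hx1', abs_of_pos hy1', abs_of_pos hz1', abs_of_pos hxyz', ← mul_assoc,
    mul_comm (Real.Gamma a), mul_assoc, ENNReal.ofReal_mul (by positivity),
    ofReal_Gamma_mul_one_sub_rpow ha (by positivity) hxyz, ← ENNReal.tsum_mul_left]
  refine tsum_congr fun k => ?_
  have g4 := hG (hk k ha)
  rw [← ENNReal.ofReal_mul (by positivity), ← ENNReal.ofReal_mul (by positivity),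
    ← ENNReal.ofReal_mul (by positivity), ← ENNReal.ofReal_mul (by positivity)]
  congr 1
  rw [add_sub_right_comm b₁, add_sub_right_comm b₂, add_sub_right_comm b₃,
    Real.rpow_add_natCast hx0.ne', Real.rpow_add_natCast hy0.ne', Real.rpow_add_natCast hz0.ne']
  ring

open MeasureTheory Set in
theorem lintegral_eulerFn_Ioi {a b₁ b₂ b₃ c₁ c₂ c₃ d₁ d₂ d₃ : ℝ} (ha : 0 < a) (hc₁ : 0 < c₁)
    (hc₂ : 0 < c₂) (hc₃ : 0 < c₃) (hd₁ : 0 < d₁) (hd₂ : 0 < d₂) (hd₃ : 0 < d₃)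
    (h₁ : b₁ + c₁ + d₁ = 1 + a) (h₂ : b₂ + c₂ + d₂ = 1 + a) (h₃ : b₃ + c₃ + d₃ = 1 + a) :
    ∫⁻ z in Ioi (1 : ℝ), ∫⁻ y in Ioi (1 : ℝ), ∫⁻ x in Ioi (1 : ℝ),
      ENNReal.ofReal (Real.Gamma a * eulerFn a b₁ b₂ b₃ d₁ d₂ d₃ x y z) =
      ∑' k : ℕ, ENNReal.ofReal (eulerCoeff a c₁ c₂ c₃ d₁ d₂ d₃ k) := by
  have key := lintegral_three_tsum (Ioi (1 : ℝ))
    (fun k => ENNReal.ofReal (Real.Gamma (a + k) / k.factorial))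
    (fun k x => ENNReal.ofReal (x ^ (-(c₁ + k) - d₁) * (x - 1) ^ (d₁ - 1)))
    (fun k x => ENNReal.ofReal (x ^ (-(c₂ + k) - d₂) * (x - 1) ^ (d₂ - 1)))
    (fun k x => ENNReal.ofReal (x ^ (-(c₃ + k) - d₃) * (x - 1) ^ (d₃ - 1)))
    (fun k => by fun_prop) (fun k => by fun_prop) (fun k => by fun_prop)
  have hG : ∀ {u : ℝ}, 0 < u → 0 < Real.Gamma u := Real.Gamma_pos_of_pos
  have hk : ∀ (k : ℕ) {u : ℝ}, 0 < u → 0 < u + k := fun k u hu => by positivity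
  have hR : ∀ k : ℕ, ENNReal.ofReal (eulerCoeff a c₁ c₂ c₃ d₁ d₂ d₃ k) =
      ENNReal.ofReal (Real.Gamma (a + k) / k.factorial) *
      ((∫⁻ x in Ioi (1 : ℝ), ENNReal.ofReal (x ^ (-(c₁ + k) - d₁) * (x - 1) ^ (d₁ - 1))) *
      ((∫⁻ x in Ioi (1 : ℝ), ENNReal.ofReal (x ^ (-(c₂ + k) - d₂) * (x - 1) ^ (d₂ - 1))) *
      ∫⁻ x in Ioi (1 : ℝ), ENNReal.ofReal (x ^ (-(c₃ + k) - d₃) * (x - 1) ^ (d₃ - 1)))) := by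
    intro k
    have g1 := hG (hk k hc₁)
    have g2 := hG (hk k hc₂)
    have g3 := hG (hk k hc₃)
    have g4 := hG (hk k ha)
    have g5 := hG hd₁
    have g6 := hG hd₂
    have g7 := hG hd₃
    have g8 := hG (add_pos (hk k hc₁) hd₁)
    have g9 := hG (add_pos (hk k hc₂) hd₂)
    rw [lintegral_beta_Ioi_one (hk k hc₁) hd₁, lintegral_beta_Ioi_one (hk k hc₂) hd₂,
      lintegral_beta_Ioi_one (hk k hc₃) hd₃,
      ← ENNReal.ofReal_mul (by positivity), ← ENNReal.ofReal_mul (by positivity),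
      ← ENNReal.ofReal_mul (by positivity)]
    rfl
  simp_rw [hR]
  rw [← key]
  refine setLIntegral_congr_fun measurableSet_Ioi fun z hz => ?_
  refine setLIntegral_congr_fun measurableSet_Ioi fun y hy => ?_
  refine setLIntegral_congr_fun measurableSet_Ioi fun x hx => ?_
  have hx0 : 0 < x := one_pos.trans hx
  have hy0 : 0 < y := one_pos.trans hy
  have hz0 : 0 < z := one_pos.trans hz
  have hx1' := sub_pos.2 (mem_Ioi.1 hx)
  have hy1' := sub_pos.2 (mem_Ioi.1 hy)
  have hz1' := sub_pos.2 (mem_Ioi.1 hz)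
  have hxyz : 1 < x * y * z := by
    have : 1 < x * y := one_lt_mul_of_lt_of_le (mem_Ioi.1 hx) (mem_Ioi.1 hy).le
    exact one_lt_mul_of_lt_of_le this (mem_Ioi.1 hz).le
  have hxyz' := sub_pos.2 hxyz
  have hinv : 0 < 1 - (x * y * z)⁻¹ := sub_pos.2 (inv_lt_one_of_one_lt₀ hxyz)
  have hsplit : (x * y * z - 1) ^ (-a) = (x * y * z) ^ (-a) * (1 - (x * y * z)⁻¹) ^ (-a) := by
    rw [← Real.mul_rpow (by positivity) hinv.le]
    congr 1
    field_simp
  simp only [eulerFn]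
  rw [abs_sub_comm 1 x, abs_sub_comm 1 y, abs_sub_comm 1 z, abs_sub_comm 1 (x * y * z),
    abs_of_pos hx1', abs_of_pos hy1', abs_of_pos hz1', abs_of_pos hxyz', hsplit, ← mul_assoc,
    ← mul_assoc, mul_assoc (Real.Gamma a), mul_comm (Real.Gamma a), mul_assoc,
    ENNReal.ofReal_mul (by positivity),
    ofReal_Gamma_mul_one_sub_rpow ha (by positivity) (inv_lt_one_of_one_lt₀ hxyz),
    ← ENNReal.tsum_mul_left]
  refine tsum_congr fun k => ?_
  have g4 := hG (hk k ha)
  rw [← ENNReal.ofReal_mul (by positivity), ← ENNReal.ofReal_mul (by positivity),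
    ← ENNReal.ofReal_mul (by positivity), ← ENNReal.ofReal_mul (by positivity)]
  congr 1
  have e : ∀ {u b c d : ℝ}, 0 < u → b + c + d = 1 + a →
      u ^ (-(c + k) - d) = u ^ (b - 1) * u ^ (-a) * (u⁻¹) ^ k := by
    intro u b c d hu h
    rw [inv_pow, ← Real.rpow_natCast, ← Real.rpow_neg hu.le, ← Real.rpow_add hu, ← Real.rpow_add hu]
    congr 1
    linear_combination -h
  rw [e hx0 h₁, e hy0 h₂, e hz0 h₃, Real.mul_rpow (by positivity) hz0.le,
    Real.mul_rpow hx0.le hy0.le, mul_inv, mul_inv, mul_pow, mul_pow]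
  ring

/-- The integrand `H` after the substitution `y = ξ / z`, `z = (1 + u ξ) / (1 + u)`,
`x = 1 - T (1 - ξ) / ξ`. -/
def eulerPullback (H : ℝ → ℝ → ℝ → ENNReal) (T ξ u : ℝ) : ENNReal :=
  ENNReal.ofReal |(ξ - 1) / (1 + u) ^ 2| * (ENNReal.ofReal |1 / ((1 + u * ξ) / (1 + u))| *
    (ENNReal.ofReal |-((1 - ξ) / ξ)| *
      H (1 - T * ((1 - ξ) / ξ)) (ξ / ((1 + u * ξ) / (1 + u))) ((1 + u * ξ) / (1 + u))))

theorem measurable_eulerPullback {H : ℝ → ℝ → ℝ → ENNReal}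
    (hH : Measurable fun p : ℝ × ℝ × ℝ => H p.1 p.2.1 p.2.2) {α : Type*} [MeasurableSpace α]
    {T ξ u : α → ℝ} (hT : Measurable T) (hξ : Measurable ξ) (hu : Measurable u) :
    Measurable fun t => eulerPullback H (T t) (ξ t) (u t) := by
  have h2 : Measurable fun t => H (1 - T t * ((1 - ξ t) / ξ t))
      (ξ t / ((1 + u t * ξ t) / (1 + u t))) ((1 + u t * ξ t) / (1 + u t)) :=
    hH.comp (f := fun t => (1 - T t * ((1 - ξ t) / ξ t),
      ξ t / ((1 + u t * ξ t) / (1 + u t)), (1 + u t * ξ t) / (1 + u t))) (by fun_prop)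
  unfold eulerPullback
  fun_prop

open MeasureTheory Set in
theorem lintegral_eq_eulerPullback (σ : ℝ) {H : ℝ → ℝ → ℝ → ENNReal}
    (hH : Measurable fun p : ℝ × ℝ × ℝ => H p.1 p.2.1 p.2.2) :
    ∫⁻ z in {z : ℝ | 0 < z ∧ 0 < σ * (1 - z)}, ∫⁻ y in {y : ℝ | 0 < y ∧ 0 < σ * (1 - y)},
      ∫⁻ x in {x : ℝ | 0 < x ∧ 0 < σ * (1 - x)}, H x y z =
    ∫⁻ T in Ioi (0 : ℝ), ∫⁻ ξ in {ξ : ℝ | 0 < ξ ∧ 0 < σ * (1 - ξ) ∧ T * (1 - ξ) < ξ},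
      ∫⁻ u in Ioi (0 : ℝ), eulerPullback H T ξ u := by
  have mlt : ∀ {α : Type} [MeasurableSpace α] {f g : α → ℝ}, Measurable f → Measurable g →
      MeasurableSet {x | f x < g x} := fun hf hg => measurableSet_lt hf hg
  have hs : MeasurableSet {z : ℝ | 0 < z ∧ 0 < σ * (1 - z)} :=
    (mlt (by fun_prop) (by fun_prop)).inter (mlt (by fun_prop) (by fun_prop))
  set s := {z : ℝ | 0 < z ∧ 0 < σ * (1 - z)} with hsdef
  have hH' : Measurable fun p : ((ℝ × ℝ) × ℝ) => H p.2 (p.1.2 / p.1.1) p.1.1 :=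
    hH.comp (f := fun p : ((ℝ × ℝ) × ℝ) => (p.2, p.1.2 / p.1.1, p.1.1)) (by fun_prop)
  calc
    _ = ∫⁻ z in s, ∫⁻ ξ in {ξ | 0 < ξ ∧ 0 < σ * (z - ξ)}, ENNReal.ofReal |1 / z| *
        ∫⁻ x in s, H x (ξ / z) z := by
      refine setLIntegral_congr_fun hs fun z hz => ?_
      have hz0 := hz.1
      refine lintegral_subst (φ := fun ξ => ξ / z) (φ' := fun _ => 1 / z) (ψ := fun y => y * z)
        ((mlt (by fun_prop) (by fun_prop)).inter (mlt (by fun_prop) (by fun_prop))) ?_ ?_ ?_ ?_ ?_ _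
      · intro x hx
        refine ⟨div_pos hx.1 hz0, ?_⟩
        have : σ * (1 - x / z) = σ * (z - x) / z := by field_simp
        rw [this]
        exact div_pos hx.2 hz0
      · intro y hy
        refine ⟨mul_pos hy.1 hz0, ?_⟩
        have : σ * (z - y * z) = σ * (1 - y) * z := by ring
        show 0 < σ * (z - y * z)
        rw [this]
        exact mul_pos hy.2 hz0
      · intro y _
        field_simp
      · intro y _
        field_simp
      · intro x _
        exact (hasDerivAt_id x).div_const z
    _ = ∫⁻ ξ in s, ∫⁻ z in {z | 0 < z ∧ 0 < σ * (z - ξ) ∧ 0 < σ * (1 - z)},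
        ENNReal.ofReal |1 / z| * ∫⁻ x in s, H x (ξ / z) z := by
      refine lintegral_swap_region (A := s) (C := s) (B := fun z => {ξ | 0 < ξ ∧ 0 < σ * (z - ξ)})
        (D := fun ξ => {z | 0 < z ∧ 0 < σ * (z - ξ) ∧ 0 < σ * (1 - z)}) hs hs
        (fun z => (mlt (by fun_prop) (by fun_prop)).inter (mlt (by fun_prop) (by fun_prop)))
        (fun z => (mlt (by fun_prop) (by fun_prop)).inter
          ((mlt (by fun_prop) (by fun_prop)).inter (mlt (by fun_prop) (by fun_prop)))) ?_ ?_ ?_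
      · intro x y
        simp only [hsdef, mem_ofPred_eq]
        constructor
        · rintro ⟨⟨h1, h2⟩, h3, h4⟩
          exact ⟨⟨h3, by linarith⟩, h1, h4, h2⟩
        · rintro ⟨⟨h1, h2⟩, h3, h4, h5⟩
          exact ⟨⟨h3, h5⟩, h1, h4⟩
      · exact (measurable_fst hs).inter
          ((mlt (by fun_prop) (by fun_prop)).inter (mlt (by fun_prop) (by fun_prop)))
      · have : Measurable fun p : ℝ × ℝ => ∫⁻ x in s, H x (p.2 / p.1) p.1 :=
            hH'.lintegral_prod_right'
        unfold Function.uncurry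
        fun_prop
    _ = ∫⁻ ξ in s, ∫⁻ u in Ioi (0 : ℝ), ∫⁻ T in {T : ℝ | 0 < T ∧ T * (1 - ξ) < ξ},
        eulerPullback H T ξ u := by
      refine setLIntegral_congr_fun hs fun ξ hξ => ?_
      obtain ⟨hξ0, hξ1⟩ := hξ
      have hne : 1 - ξ ≠ 0 := fun h => by rw [h, mul_zero] at hξ1; exact hξ1.ne rfl
      rw [lintegral_subst (s := Ioi (0 : ℝ)) (φ := fun u => (1 + u * ξ) / (1 + u))
        (φ' := fun u => (ξ - 1) / (1 + u) ^ 2) (ψ := fun z => (1 - z) / (z - ξ)) measurableSet_Ioi]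
      · refine setLIntegral_congr_fun measurableSet_Ioi fun u hu => ?_
        have hu0 : 0 < u := hu
        simp only [eulerPullback]
        rw [lintegral_const_mul' _ _ ENNReal.ofReal_ne_top,
          lintegral_const_mul' _ _ ENNReal.ofReal_ne_top]
        congr 2
        refine lintegral_subst (φ := fun T => 1 - T * ((1 - ξ) / ξ)) (φ' := fun _ => -((1 - ξ) / ξ))
          (ψ := fun x => (1 - x) * ξ / (1 - ξ))
          ((mlt (by fun_prop) (by fun_prop)).inter (mlt (by fun_prop) (by fun_prop)))
          ?_ ?_ ?_ ?_ ?_ _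
        · rintro T ⟨hT0, hT⟩
          have e1 : 1 - T * ((1 - ξ) / ξ) = (ξ - T * (1 - ξ)) / ξ := by field_simp
          have e2 : σ * (1 - (1 - T * ((1 - ξ) / ξ))) = σ * (1 - ξ) * T / ξ := by
            field_simp
            ring
          refine ⟨?_, ?_⟩
          · rw [e1]
            exact div_pos (sub_pos.2 hT) hξ0
          · rw [e2]
            exact div_pos (mul_pos hξ1 hT0) hξ0
        · rintro x ⟨hx0, hx1⟩
          have e1 : (1 - x) * ξ / (1 - ξ) = (σ * (1 - x)) * ξ / (σ * (1 - ξ)) := by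
            rw [mul_assoc, mul_div_mul_left]
            rintro rfl
            simp at hξ1
          refine ⟨?_, ?_⟩
          · show 0 < (1 - x) * ξ / (1 - ξ)
            rw [e1]
            positivity
          · show (1 - x) * ξ / (1 - ξ) * (1 - ξ) < ξ
            rw [div_mul_cancel₀ _ hne]
            nlinarith
        · intro x _
          field_simp
          ring
        · intro T _
          field_simp
          ring
        · intro T _
          simpa using ((hasDerivAt_id T).mul_const ((1 - ξ) / ξ)).const_sub 1
      · intro u hu
        have hu0 : 0 < u := hu
        have e1 : σ * ((1 + u * ξ) / (1 + u) - ξ) = σ * (1 - ξ) / (1 + u) := by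
          field_simp
          ring
        have e2 : σ * (1 - (1 + u * ξ) / (1 + u)) = σ * (1 - ξ) * u / (1 + u) := by
          field_simp
          ring
        refine ⟨by positivity, ?_, ?_⟩
        · rw [e1]
          positivity
        · rw [e2]
          positivity
      · rintro z ⟨hz0, hz1, hz2⟩
        have e1 : (1 - z) / (z - ξ) = (σ * (1 - z)) / (σ * (z - ξ)) := by
          rw [mul_div_mul_left]
          rintro rfl
          simp at hξ1
        show 0 < (1 - z) / (z - ξ)
        rw [e1]
        positivity
      · rintro z ⟨hz0, hz1, hz2⟩
        have h1 : z - ξ ≠ 0 := fun h => by rw [h, mul_zero] at hz1; exact hz1.ne rfl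
        have h2 : 1 + (1 - z) / (z - ξ) = (1 - ξ) / (z - ξ) := by
          field_simp
          ring
        simp only [h2]
        field_simp
        ring
      · intro u hu
        have hu0 : 0 < u := hu
        have e1 : (1 + u * ξ) / (1 + u) - ξ = (1 - ξ) / (1 + u) := by
          field_simp
          ring
        have e2 : 1 - (1 + u * ξ) / (1 + u) = (1 - ξ) * u / (1 + u) := by
          field_simp
          ring
        simp only [e1, e2]
        field_simp
      · intro u hu
        have hu0 : 1 + u ≠ 0 := by linarith [mem_Ioi.1 hu]
        have := (((hasDerivAt_id u).mul_const ξ).const_add 1).div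
          ((hasDerivAt_id u).const_add 1) hu0
        convert! this using 1
        simp only [id]
        ring
    _ = ∫⁻ ξ in s, ∫⁻ T in {T : ℝ | 0 < T ∧ T * (1 - ξ) < ξ}, ∫⁻ u in Ioi (0 : ℝ),
        eulerPullback H T ξ u := by
      refine setLIntegral_congr_fun hs fun ξ _ => ?_
      refine lintegral_lintegral_swap (f := fun u T => eulerPullback H T ξ u) ?_
      exact (measurable_eulerPullback hH measurable_snd measurable_const
        measurable_fst).aemeasurable
    _ = _ := by
      refine lintegral_swap_region (A := s) (C := Ioi (0 : ℝ))
        (B := fun ξ => {T : ℝ | 0 < T ∧ T * (1 - ξ) < ξ})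
        (D := fun T => {ξ : ℝ | 0 < ξ ∧ 0 < σ * (1 - ξ) ∧ T * (1 - ξ) < ξ}) hs measurableSet_Ioi
        (fun z => (mlt (by fun_prop) (by fun_prop)).inter (mlt (by fun_prop) (by fun_prop)))
        (fun z => (mlt (by fun_prop) (by fun_prop)).inter
          ((mlt (by fun_prop) (by fun_prop)).inter (mlt (by fun_prop) (by fun_prop)))) ?_ ?_ ?_
      · intro x y
        simp only [hsdef, mem_ofPred_eq, mem_Ioi]
        tauto
      · exact (measurable_fst hs).inter
          ((mlt (by fun_prop) (by fun_prop)).inter (mlt (by fun_prop) (by fun_prop)))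
      · exact Measurable.lintegral_prod_right' (f := fun p : (ℝ × ℝ) × ℝ =>
            eulerPullback H p.1.2 p.1.1 p.2)
          (measurable_eulerPullback hH (by fun_prop) (by fun_prop) (by fun_prop))

open MeasureTheory Set in
theorem lintegral_unit_add_lintegral_Ioi {H : ℝ → ℝ → ℝ → ENNReal}
    (hH : Measurable fun p : ℝ × ℝ × ℝ => H p.1 p.2.1 p.2.2) :
    (∫⁻ z in Ioo (0 : ℝ) 1, ∫⁻ y in Ioo (0 : ℝ) 1, ∫⁻ x in Ioo (0 : ℝ) 1, H x y z) +
      ∫⁻ z in Ioi (1 : ℝ), ∫⁻ y in Ioi (1 : ℝ), ∫⁻ x in Ioi (1 : ℝ), H x y z =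
    ∫⁻ T in Ioi (0 : ℝ), ∫⁻ P in Ioo (0 : ℝ) 1, ∫⁻ w in Ioi (0 : ℝ),
      ENNReal.ofReal |-(T / ((1 + T) * P ^ 2))| *
        (ENNReal.ofReal |P| * eulerPullback H T (T / ((1 + T) * P)) (P * w)) := by
  have mlt : ∀ {α : Type} [MeasurableSpace α] {f g : α → ℝ}, Measurable f → Measurable g →
      MeasurableSet {x | f x < g x} := fun hf hg => measurableSet_lt hf hg
  have hX : ∀ (σ T : ℝ), MeasurableSet {ξ : ℝ | 0 < ξ ∧ 0 < σ * (1 - ξ) ∧ T * (1 - ξ) < ξ} :=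
    fun σ T => (mlt (by fun_prop) (by fun_prop)).inter
      ((mlt (by fun_prop) (by fun_prop)).inter (mlt (by fun_prop) (by fun_prop)))
  have e1 : Ioo (0 : ℝ) 1 = {z : ℝ | 0 < z ∧ 0 < 1 * (1 - z)} := by
    ext z
    simp [mem_Ioo]
  have e2 : Ioi (1 : ℝ) = {z : ℝ | 0 < z ∧ 0 < (-1) * (1 - z)} := by
    ext z
    simp only [mem_Ioi, mem_ofPred_eq]
    constructor
    · intro h
      exact ⟨by linarith, by linarith⟩
    · rintro ⟨_, h⟩
      linarith
  have hE : ∀ T : ℝ, Measurable fun ξ => ∫⁻ u in Ioi (0 : ℝ), eulerPullback H T ξ u := fun T =>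
    Measurable.lintegral_prod_right' (f := fun p : ℝ × ℝ => eulerPullback H T p.1 p.2)
      (measurable_eulerPullback hH measurable_const measurable_fst measurable_snd)
  have hE2 : Measurable fun p : ℝ × ℝ => ∫⁻ u in Ioi (0 : ℝ), eulerPullback H p.1 p.2 u :=
    Measurable.lintegral_prod_right' (f := fun p : (ℝ × ℝ) × ℝ =>
            eulerPullback H p.1.1 p.1.2 p.2)
      (measurable_eulerPullback hH (by fun_prop) (by fun_prop) (by fun_prop))
  have hmeas : Measurable fun T : ℝ => ∫⁻ ξ in {ξ : ℝ | 0 < ξ ∧ 0 < 1 * (1 - ξ) ∧ T * (1 - ξ) < ξ},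
      ∫⁻ u in Ioi (0 : ℝ), eulerPullback H T ξ u := by
    simp_rw [← lintegral_indicator (hX _ _)]
    refine Measurable.lintegral_prod_right' (f := fun p : ℝ × ℝ =>
      ({ξ : ℝ | 0 < ξ ∧ 0 < 1 * (1 - ξ) ∧ p.1 * (1 - ξ) < ξ}.indicator
        (fun ξ => ∫⁻ u in Ioi (0 : ℝ), eulerPullback H p.1 ξ u) p.2)) ?_
    have : (fun p : ℝ × ℝ => ({ξ : ℝ | 0 < ξ ∧ 0 < 1 * (1 - ξ) ∧ p.1 * (1 - ξ) < ξ}.indicator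
        (fun ξ => ∫⁻ u in Ioi (0 : ℝ), eulerPullback H p.1 ξ u) p.2)) =
        {p : ℝ × ℝ | 0 < p.2 ∧ 0 < 1 * (1 - p.2) ∧ p.1 * (1 - p.2) < p.2}.indicator
        (fun p => ∫⁻ u in Ioi (0 : ℝ), eulerPullback H p.1 p.2 u) := by
      ext p
      simp only [indicator, mem_ofPred_eq]
    rw [this]
    exact hE2.indicator ((mlt (by fun_prop) (by fun_prop)).inter
      ((mlt (by fun_prop) (by fun_prop)).inter (mlt (by fun_prop) (by fun_prop))))
  rw [e1, e2, lintegral_eq_eulerPullback 1 hH, lintegral_eq_eulerPullback (-1) hH,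
    ← lintegral_add_left hmeas]
  refine setLIntegral_congr_fun measurableSet_Ioi fun T hT => ?_
  have hT0 : 0 < T := hT
  rw [← lintegral_union (hX (-1) T) (by
    rw [Set.disjoint_left]
    rintro ξ ⟨_, h1, _⟩ ⟨_, h2, _⟩
    linarith)]
  rw [setLIntegral_congr (t := {ξ : ℝ | 0 < ξ ∧ T * (1 - ξ) < ξ})]
  · rw [← e1, lintegral_subst (s := Ioo (0 : ℝ) 1) (φ := fun P => T / ((1 + T) * P))
      (φ' := fun P => -(T / ((1 + T) * P ^ 2))) (ψ := fun ξ => T / ((1 + T) * ξ)) measurableSet_Ioo]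
    · refine setLIntegral_congr_fun measurableSet_Ioo fun P hP => ?_
      rw [lintegral_const_mul' _ _ ENNReal.ofReal_ne_top]
      congr 1
      have hP0 := hP.1
      rw [lintegral_subst (s := Ioi (0 : ℝ)) (φ := fun w => P * w) (φ' := fun _ => P)
        (ψ := fun u => u / P) measurableSet_Ioi]
      · intro w hw
        exact mul_pos hP0 hw
      · intro w hw
        exact div_pos hw hP0
      · intro w _
        field_simp
      · intro w _
        field_simp
      · intro w _
        simpa using (hasDerivAt_id w).const_mul P
    · rintro P ⟨hP0, hP1⟩
      have e : T / ((1 + T) * P) - T * (1 - T / ((1 + T) * P)) = T * (1 - P) / P := by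
        field_simp
        ring
      have h1 : 0 < 1 - P := by linarith
      have h2 : 0 < T * (1 - P) / P := by positivity
      exact ⟨by positivity, by linarith⟩
    · rintro ξ ⟨hξ0, hξ1⟩
      refine ⟨by positivity, ?_⟩
      rw [div_lt_one (by positivity)]
      linarith
    · rintro ξ ⟨hξ0, _⟩
      field_simp
    · rintro P ⟨hP0, hP1⟩
      field_simp
    · rintro P ⟨hP0, hP1⟩
      have := ((hasDerivAt_inv hP0.ne').const_mul (T / (1 + T)))
      convert! this using 1
      · ext x
        simp only [div_eq_mul_inv, mul_inv]
        ring
      · field_simp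
  · have hsub : {ξ : ℝ | 0 < ξ ∧ T * (1 - ξ) < ξ} \
        ({ξ : ℝ | 0 < ξ ∧ 0 < 1 * (1 - ξ) ∧ T * (1 - ξ) < ξ} ∪
        {ξ : ℝ | 0 < ξ ∧ 0 < -1 * (1 - ξ) ∧ T * (1 - ξ) < ξ}) ⊆ {1} := by
      rintro ξ ⟨⟨h0, h1⟩, h2⟩
      by_contra hne
      apply h2
      rcases lt_or_gt_of_ne (show ξ ≠ 1 from hne) with h | h
      · exact Or.inl ⟨h0, by linarith, h1⟩
      · exact Or.inr ⟨h0, by linarith, h1⟩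
    have hsub2 : ({ξ : ℝ | 0 < ξ ∧ 0 < 1 * (1 - ξ) ∧ T * (1 - ξ) < ξ} ∪
        {ξ : ℝ | 0 < ξ ∧ 0 < -1 * (1 - ξ) ∧ T * (1 - ξ) < ξ}) ⊆
        {ξ : ℝ | 0 < ξ ∧ T * (1 - ξ) < ξ} := by
      rintro ξ (⟨h0, _, h1⟩ | ⟨h0, _, h1⟩) <;> exact ⟨h0, h1⟩
    refine (LE.le.eventuallyLE hsub2).antisymm ?_
    rw [ae_le_set]
    exact measure_mono_null hsub (by simp)

/-- The transformed integrand of the triple Euler integral. -/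
def eulerFn' (b₁ b₂ b₃ c₂ d₂ d₃ T P w : ℝ) : ℝ :=
  P ^ (c₂ - 1) * (1 - P) ^ (b₁ - 1) * w ^ (d₃ - 1) * (1 + P * w) ^ (b₂ - b₃ - d₃) *
    (T ^ (b₂ - 1) * (1 + T) ^ (b₁ - b₃ - d₃) * (1 + T + w * T) ^ (b₃ - b₂ - d₂))

theorem eulerFn_pullback {a b₁ b₂ b₃ c₂ d₁ d₂ d₃ T P w : ℝ} (ha : a = d₁ + d₂ + d₃ - 1)
    (hc₂ : b₂ + c₂ + d₂ = 1 + a) (hT : 0 < T) (hP : 0 < P) (hP1 : P < 1) (hw : 0 < w)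
    (hne : P ≠ T / (1 + T)) :
    ENNReal.ofReal |-(T / ((1 + T) * P ^ 2))| * (ENNReal.ofReal |P| *
      eulerPullback (fun x y z =>
          ENNReal.ofReal (Real.Gamma a * eulerFn a b₁ b₂ b₃ d₁ d₂ d₃ x y z))
        T (T / ((1 + T) * P)) (P * w)) =
    ENNReal.ofReal (Real.Gamma a * eulerFn' b₁ b₂ b₃ c₂ d₂ d₃ T P w) := by
  unfold eulerPullback
  rw [← ENNReal.ofReal_mul (abs_nonneg _), ← ENNReal.ofReal_mul (abs_nonneg _),
    ← ENNReal.ofReal_mul (abs_nonneg _), ← ENNReal.ofReal_mul (abs_nonneg _),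
    ← ENNReal.ofReal_mul (abs_nonneg _)]
  congr 1
  have hP1' : 0 < 1 - P := sub_pos.2 hP1
  set ξ := T / ((1 + T) * P) with hξ
  have hξ0 : 0 < ξ := by positivity
  set q := |1 - ξ| with hq
  have hq0 : 0 < q := by
    rw [hq, abs_pos]
    intro h
    apply hne
    have : ξ = 1 := by linarith
    rw [hξ, div_eq_one_iff_eq (by positivity)] at this
    field_simp
    linarith
  have hTw : 0 < 1 + T + w * T := by positivity
  have hPw : 0 < 1 + P * w := by positivity
  have h1T : 0 < 1 + T := by positivity
  have hx : 1 - T * ((1 - ξ) / ξ) = (1 + T) * (1 - P) := by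
    rw [hξ]
    field_simp
    ring
  have hz : (1 + P * w * ξ) / (1 + P * w) = (1 + T + w * T) / ((1 + T) * (1 + P * w)) := by
    rw [hξ]
    field_simp
  have hy : ξ / ((1 + T + w * T) / ((1 + T) * (1 + P * w))) =
      T * (1 + P * w) / (P * (1 + T + w * T)) := by
    rw [hξ]
    field_simp
  have habs : ∀ {r s : ℝ}, 0 < s → r = (1 - ξ) * s → |r| = q * s := by
    intro r s hs h
    rw [h, abs_mul, abs_of_pos hs]
  have h1x : |1 - (1 + T) * (1 - P)| = q * ((1 + T) * P) := by
    refine habs (by positivity) ?_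
    rw [hξ]
    field_simp
    ring
  have h1y : |1 - T * (1 + P * w) / (P * (1 + T + w * T))| = q * ((1 + T) / (1 + T + w * T)) := by
    refine habs (by positivity) ?_
    rw [hξ]
    field_simp
    ring
  have h1z : |1 - (1 + T + w * T) / ((1 + T) * (1 + P * w))| = q * (P * w / (1 + P * w)) := by
    refine habs (by positivity) ?_
    rw [hξ]
    field_simp
    ring
  have h1xyz : |1 - (1 + T) * (1 - P) * (T * (1 + P * w) / (P * (1 + T + w * T))) *
      ((1 + T + w * T) / ((1 + T) * (1 + P * w)))| = q * (1 + T) := by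
    refine habs (by positivity) ?_
    rw [hξ]
    field_simp
    ring
  have j1 : |(ξ - 1) / (1 + P * w) ^ 2| = q * (1 / (1 + P * w) ^ 2) := by
    rw [← abs_neg]
    refine habs (by positivity) ?_
    ring
  have j2 : |-((1 - ξ) / ξ)| = q * (1 / ξ) := by
    rw [abs_neg]
    exact habs (by positivity) (by ring)
  rw [hx, hz, hy, eulerFn, h1x, h1y, h1z, h1xyz, j1, j2, abs_neg, abs_of_pos hP,
    abs_of_pos (show 0 < T / ((1 + T) * P ^ 2) by positivity), one_div_div,
    abs_of_pos (show 0 < (1 + T) * (1 + P * w) / (1 + T + w * T) by positivity), eulerFn']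
  have hJ : T / ((1 + T) * P ^ 2) * (P * (q * (1 / (1 + P * w) ^ 2) *
      ((1 + T) * (1 + P * w) / (1 + T + w * T) * (q * (1 / ξ))))) =
      Real.exp (2 * Real.log q + Real.log (1 + T) - Real.log (1 + P * w) -
        Real.log (1 + T + w * T)) := by
    rw [Real.exp_sub, Real.exp_sub, Real.exp_add, two_mul, Real.exp_add, Real.exp_log hq0,
      Real.exp_log h1T, Real.exp_log hPw, Real.exp_log hTw, hξ]
    field_simp
  have hlog : ∀ {u v : ℝ}, 0 < u → 0 < v → Real.log (u * v) = Real.log u + Real.log v :=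
    fun hu hv => Real.log_mul hu.ne' hv.ne'
  have hlogd : ∀ {u v : ℝ}, 0 < u → 0 < v → Real.log (u / v) = Real.log u - Real.log v :=
    fun hu hv => Real.log_div hu.ne' hv.ne'
  have rp : ∀ {u : ℝ} (v : ℝ), 0 < u → u ^ v = Real.exp (Real.log u * v) :=
    fun v hu => Real.rpow_def_of_pos hu v
  have rearr : ∀ A B C D E G F : ℝ, A * (B * (C * (D * (E * (G * F))))) =
      G * ((A * (B * (C * (D * E)))) * F) := by
    intros
    ring
  rw [rearr, hJ]
  congr 1
  rw [rp _ (by positivity : 0 < (1 + T) * (1 - P)), rp _ (by positivity : 0 < q * ((1 + T) * P)),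
    rp _ (by positivity : 0 < T * (1 + P * w) / (P * (1 + T + w * T))),
    rp _ (by positivity : 0 < q * ((1 + T) / (1 + T + w * T))),
    rp _ (by positivity : 0 < (1 + T + w * T) / ((1 + T) * (1 + P * w))),
    rp _ (by positivity : 0 < q * (P * w / (1 + P * w))),
    rp _ (by positivity : 0 < q * (1 + T)), rp _ hP, rp _ hP1', rp _ hw, rp _ hPw, rp _ hT,
    rp _ h1T, rp _ hTw, hlog h1T hP1', hlog hq0 (by positivity), hlog h1T hP,
    hlogd (by positivity) (by positivity), hlog hT hPw, hlog hP hTw,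
    hlog hq0 (by positivity), hlogd h1T hTw, hlogd hTw (by positivity), hlog h1T hPw,
    hlog hq0 (by positivity), hlogd (by positivity) hPw, hlog hP hw, hlog hq0 h1T]
  simp only [← Real.exp_add]
  congr 1
  have : c₂ = d₁ + d₃ - b₂ := by linarith
  rw [this, ha]
  ring

/-- An Euler integral of Gauss type. -/
def gaussIntegral (A B C ρ : ℝ) : ENNReal :=
  ∫⁻ T in Set.Ioi (0 : ℝ), ENNReal.ofReal (T ^ (A - 1) * (1 + T) ^ (B - C) * (1 + ρ * T) ^ (-B))

open MeasureTheory Set in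
theorem gaussIntegral_mul {A B C ρ : ℝ} (hB : 0 < B) (hBC : B < C) (hρ : 0 < ρ) :
    ENNReal.ofReal (Real.Gamma B * Real.Gamma (C - B) / Real.Gamma C) * gaussIntegral A B C ρ =
      ∫⁻ T in Ioi (0 : ℝ), ∫⁻ R in Ioi (0 : ℝ),
        ENNReal.ofReal (T ^ (A - 1) * R ^ (B - 1) * (1 + T + R + ρ * (T * R)) ^ (-C)) := by
  have g1 := Real.Gamma_pos_of_pos hB
  have g2 := Real.Gamma_pos_of_pos (sub_pos.2 hBC)
  have g3 := Real.Gamma_pos_of_pos (hB.trans hBC)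
  rw [gaussIntegral, ← lintegral_const_mul' _ _ ENNReal.ofReal_ne_top]
  refine setLIntegral_congr_fun measurableSet_Ioi fun T hT => ?_
  have hT0 : 0 < T := hT
  have h := lintegral_rpow_mul_add_rpow hB hBC (show 0 < 1 + T by positivity)
    (show 0 < 1 + ρ * T by positivity)
  calc _ = ENNReal.ofReal (T ^ (A - 1)) * ENNReal.ofReal ((1 + T) ^ (B - C) * (1 + ρ * T) ^ (-B) *
        (Real.Gamma B * Real.Gamma (C - B) / Real.Gamma C)) := by
        rw [← ENNReal.ofReal_mul (by positivity), ← ENNReal.ofReal_mul (by positivity)]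
        congr 1
        ring
    _ = _ := by
        rw [← h, ← lintegral_const_mul' _ _ ENNReal.ofReal_ne_top]
        refine setLIntegral_congr_fun measurableSet_Ioi fun R hR => ?_
        have hR0 : 0 < R := hR
        rw [← ENNReal.ofReal_mul (by positivity)]
        congr 1
        rw [← mul_assoc]
        congr 2
        ring

open MeasureTheory Set in
theorem gaussIntegral_symm {A B C ρ : ℝ} (hA : 0 < A) (hB : 0 < B) (hAC : A < C) (hBC : B < C)
    (hρ : 0 < ρ) :
    ENNReal.ofReal (Real.Gamma B * Real.Gamma (C - B)) * gaussIntegral A B C ρ =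
      ENNReal.ofReal (Real.Gamma A * Real.Gamma (C - A)) * gaussIntegral B A C ρ := by
  have key : ENNReal.ofReal (Real.Gamma B * Real.Gamma (C - B) / Real.Gamma C) *
      gaussIntegral A B C ρ =
      ENNReal.ofReal (Real.Gamma A * Real.Gamma (C - A) / Real.Gamma C) *
        gaussIntegral B A C ρ := by
    rw [gaussIntegral_mul hB hBC hρ, gaussIntegral_mul hA hAC hρ, lintegral_lintegral_swap]
    · refine lintegral_congr fun R => lintegral_congr fun T => ?_
      congr 2
      · ring
      · congr 1
        ring
    · unfold Function.uncurry
      fun_prop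
  have hC := Real.Gamma_pos_of_pos (hA.trans hAC)
  have e : ∀ {x : ℝ}, ENNReal.ofReal x =
      ENNReal.ofReal (Real.Gamma C) * ENNReal.ofReal (x / Real.Gamma C) := by
    intro x
    rw [← ENNReal.ofReal_mul hC.le, mul_div_cancel₀ _ hC.ne']
  rw [e, mul_assoc, key, ← mul_assoc, ← e]

open MeasureTheory Set in
theorem tsum_eulerCoeff_add {a b₁ b₂ b₃ c₁ c₂ c₃ d₁ d₂ d₃ : ℝ} (ha : 0 < a) (hb₁ : 0 < b₁)
    (hb₂ : 0 < b₂) (hb₃ : 0 < b₃) (hc₁ : 0 < c₁) (hc₂ : 0 < c₂) (hc₃ : 0 < c₃) (hd₁ : 0 < d₁)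
    (hd₂ : 0 < d₂) (hd₃ : 0 < d₃) (h₁ : b₁ + c₁ + d₁ = 1 + a) (h₂ : b₂ + c₂ + d₂ = 1 + a)
    (h₃ : b₃ + c₃ + d₃ = 1 + a) (hd : d₁ + d₂ + d₃ = 1 + a) :
    (∑' k : ℕ, ENNReal.ofReal (eulerCoeff a b₁ b₂ b₃ d₁ d₂ d₃ k)) +
      ∑' k : ℕ, ENNReal.ofReal (eulerCoeff a c₁ c₂ c₃ d₁ d₂ d₃ k) =
    ENNReal.ofReal (Real.Gamma a) * ∫⁻ P in Ioo (0 : ℝ) 1, ∫⁻ w in Ioi (0 : ℝ),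
      ENNReal.ofReal (P ^ (c₂ - 1) * (1 - P) ^ (b₁ - 1) * w ^ (d₃ - 1) *
        (1 + P * w) ^ (b₂ - b₃ - d₃)) * gaussIntegral b₂ (b₂ + d₂ - b₃) (b₂ + c₁) (1 + w) := by
  rw [← lintegral_eulerFn_unit ha hb₁ hb₂ hb₃ hd₁ hd₂ hd₃,
    ← lintegral_eulerFn_Ioi ha hc₁ hc₂ hc₃ hd₁ hd₂ hd₃ h₁ h₂ h₃,
    lintegral_unit_add_lintegral_Ioi (((measurable_eulerFn a b₁ b₂ b₃ d₁ d₂ d₃ measurable_fst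
      (measurable_fst.comp measurable_snd) (measurable_snd.comp measurable_snd)).const_mul
      (Real.Gamma a)).ennreal_ofReal)]
  have e1 : ∫⁻ T in Ioi (0 : ℝ), ∫⁻ P in Ioo (0 : ℝ) 1, ∫⁻ w in Ioi (0 : ℝ),
      ENNReal.ofReal |-(T / ((1 + T) * P ^ 2))| * (ENNReal.ofReal |P| *
        eulerPullback (fun x y z =>
          ENNReal.ofReal (Real.Gamma a * eulerFn a b₁ b₂ b₃ d₁ d₂ d₃ x y z))
          T (T / ((1 + T) * P)) (P * w)) =
      ∫⁻ T in Ioi (0 : ℝ), ∫⁻ P in Ioo (0 : ℝ) 1, ∫⁻ w in Ioi (0 : ℝ),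
        ENNReal.ofReal (Real.Gamma a * eulerFn' b₁ b₂ b₃ c₂ d₂ d₃ T P w) := by
    refine setLIntegral_congr_fun measurableSet_Ioi fun T hT => ?_
    refine setLIntegral_congr_fun_ae measurableSet_Ioo ?_
    have : ∀ᵐ P : ℝ, P ≠ T / (1 + T) := by
      simp [ae_iff]
    filter_upwards [this] with P hne hP
    refine setLIntegral_congr_fun measurableSet_Ioi fun w hw => ?_
    exact eulerFn_pullback (by linarith) h₂ hT hP.1 hP.2 hw hne
  have hm : ∀ {α : Type} [MeasurableSpace α] {T P w : α → ℝ}, Measurable T → Measurable P →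
      Measurable w → Measurable fun t => ENNReal.ofReal
        (Real.Gamma a * eulerFn' b₁ b₂ b₃ c₂ d₂ d₃ (T t) (P t) (w t)) := by
    intros
    unfold eulerFn'
    fun_prop
  rw [e1, lintegral_lintegral_swap]
  · rw [← lintegral_const_mul' _ _ ENNReal.ofReal_ne_top]
    refine setLIntegral_congr_fun measurableSet_Ioo fun P hP => ?_
    have hP0 : 0 < P := hP.1
    have hP1 : 0 < 1 - P := sub_pos.2 hP.2
    rw [← lintegral_const_mul' _ _ ENNReal.ofReal_ne_top, lintegral_lintegral_swap]
    · refine setLIntegral_congr_fun measurableSet_Ioi fun w hw => ?_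
      have hw0 : 0 < w := hw
      have gp := Real.Gamma_pos_of_pos ha
      rw [gaussIntegral, ← lintegral_const_mul' _ _ ENNReal.ofReal_ne_top,
        ← lintegral_const_mul' _ _ ENNReal.ofReal_ne_top]
      refine setLIntegral_congr_fun measurableSet_Ioi fun T hT => ?_
      have hT0 : 0 < T := hT
      rw [← ENNReal.ofReal_mul (by positivity), ← ENNReal.ofReal_mul (by positivity), eulerFn',
        show 1 + (1 + w) * T = 1 + T + w * T by ring,
        show b₂ + d₂ - b₃ - (b₂ + c₁) = b₁ - b₃ - d₃ by linarith,
        show -(b₂ + d₂ - b₃) = b₃ - b₂ - d₂ by ring]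
    · exact (hm measurable_fst measurable_const measurable_snd).aemeasurable
  · exact (Measurable.lintegral_prod_right' (f := fun p : (ℝ × ℝ) × ℝ => ENNReal.ofReal
        (Real.Gamma a * eulerFn' b₁ b₂ b₃ c₂ d₂ d₃ p.1.1 p.1.2 p.2))
        (hm (by fun_prop) (by fun_prop) (by fun_prop))).aemeasurable

open MeasureTheory Set in
theorem tsum_eulerCoeff_two_term {a b₁ b₂ b₃ c₁ c₂ c₃ d₁ d₂ d₃ : ℝ} (ha : 0 < a) (hb₁ : 0 < b₁)
    (hb₂ : 0 < b₂) (hb₃ : 0 < b₃) (hc₁ : 0 < c₁) (hc₂ : 0 < c₂) (hc₃ : 0 < c₃) (hd₁ : 0 < d₁)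
    (hd₂ : 0 < d₂) (hd₃ : 0 < d₃) (h₁ : b₁ + c₁ + d₁ = 1 + a) (h₂ : b₂ + c₂ + d₂ = 1 + a)
    (h₃ : b₃ + c₃ + d₃ = 1 + a) (hd : d₁ + d₂ + d₃ = 1 + a) (hb : b₃ < b₂ + d₂)
    (hc : b₁ < b₃ + d₃) :
    ENNReal.ofReal (Real.Gamma (b₂ + d₂ - b₃) * Real.Gamma (b₃ + d₃ - b₁)) *
      ((∑' k : ℕ, ENNReal.ofReal (eulerCoeff a b₁ b₂ b₃ d₁ d₂ d₃ k)) +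
        ∑' k : ℕ, ENNReal.ofReal (eulerCoeff a c₁ c₂ c₃ d₁ d₂ d₃ k)) =
    ENNReal.ofReal (Real.Gamma b₂ * Real.Gamma c₁) *
      ((∑' k : ℕ, ENNReal.ofReal (eulerCoeff a b₁ (b₂ + d₂ - b₃) d₂ c₃ b₃ d₃ k)) +
        ∑' k : ℕ, ENNReal.ofReal (eulerCoeff a (b₃ + d₃ - b₁) c₂ d₁ c₃ b₃ d₃ k)) := by
  rw [tsum_eulerCoeff_add ha hb₁ hb₂ hb₃ hc₁ hc₂ hc₃ hd₁ hd₂ hd₃ h₁ h₂ h₃ hd,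
    tsum_eulerCoeff_add ha hb₁ (sub_pos.2 hb) hd₂ (sub_pos.2 hc) hc₂ hd₁ hc₃ hb₃ hd₃ (by linarith)
      (by linarith) (by linarith) (by linarith)]
  rw [mul_left_comm, mul_left_comm (ENNReal.ofReal (Real.Gamma b₂ * Real.Gamma c₁))]
  congr 1
  rw [← lintegral_const_mul' _ _ ENNReal.ofReal_ne_top,
    ← lintegral_const_mul' _ _ ENNReal.ofReal_ne_top]
  refine setLIntegral_congr_fun measurableSet_Ioo fun P hP => ?_
  rw [← lintegral_const_mul' _ _ ENNReal.ofReal_ne_top,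
    ← lintegral_const_mul' _ _ ENNReal.ofReal_ne_top]
  refine setLIntegral_congr_fun measurableSet_Ioi fun w hw => ?_
  have hw0 : 0 < w := hw
  have hg := gaussIntegral_symm (ρ := 1 + w) hb₂ (sub_pos.2 hb) (show b₂ < b₂ + c₁ by linarith)
    (show b₂ + d₂ - b₃ < b₂ + c₁ by linarith) (by linarith)
  rw [show b₂ + c₁ - (b₂ + d₂ - b₃) = b₃ + d₃ - b₁ by linarith,
    show b₂ + c₁ - b₂ = c₁ by ring] at hg
  rw [mul_left_comm, hg, mul_left_comm, show b₂ + d₂ - b₃ + b₃ - d₂ = b₂ by ring,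
    show b₂ + d₂ - b₃ + (b₃ + d₃ - b₁) = b₂ + c₁ by linarith,
    show b₂ + d₂ - b₃ - d₂ - d₃ = b₂ - b₃ - d₃ by ring]

theorem Sn_ofReal_ne_zero {x : ℝ} (h0 : 0 < x) (h1 : x < 1) : Sn x ≠ 0 := by
  rw [Sn, ← ofReal_mul, ← ofReal_sin, ofReal_ne_zero]
  refine (Real.sin_pos_of_pos_of_lt_pi (by positivity) ?_).ne'
  have := Real.pi_pos
  nlinarith

theorem summable_Fstar {a b c d e f g : ℂ} (ha : Sn a ≠ 0) (hb : Sn b ≠ 0)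
    (hc : Sn c ≠ 0) (hd : Sn d ≠ 0) (h : e + f + g = a + b + c + d + 1) :
    Summable fun k : ℕ => (Gamma (k + a) * Gamma (k + b) * Gamma (k + c) * Gamma (k + d)) /
      (k.factorial * Gamma (k + e) * Gamma (k + f) * Gamma (k + g)) := by
  have hs := summable_bilatTerm (x := ![1 - a, 1 - b, 1 - c, 1 - d]) (y := ![1, e, f, g]) (by
    simp only [Fin.sum_univ_four, Matrix.cons_val]
    linear_combination h) 0
  have hs' := (hs.comp_injective (Nat.cast_injective (R := ℤ))).mul_left ((Real.pi : ℂ) ^ 4)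
  rw [← summable_mul_right_iff (a := Sn a * Sn b * Sn c * Sn d) (by simp [ha, hb, hc, hd])]
  refine hs'.congr fun k => ?_
  rw [bilatTerm_zero_add_nat e f g ha hb hc hd]
  rfl

theorem ofReal_eulerCoeff {a b₁ b₂ b₃ d₁ d₂ d₃ : ℝ} (k : ℕ) :
    ((eulerCoeff a b₁ b₂ b₃ d₁ d₂ d₃ k : ℝ) : ℂ) =
    (Gamma (k + a) * Gamma (k + b₁) * Gamma (k + b₂) * Gamma (k + b₃)) /
      (k.factorial * Gamma (k + ↑(b₁ + d₁)) * Gamma (k + ↑(b₂ + d₂)) * Gamma (k + ↑(b₃ + d₃))) *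
      ((Real.Gamma d₁ * Real.Gamma d₂ * Real.Gamma d₃ : ℝ) : ℂ) := by
  simp only [← ofReal_natCast, ← ofReal_add, Gamma_ofReal, ← ofReal_mul, ← ofReal_div]
  congr 1
  rw [eulerCoeff, add_comm a, add_comm b₁ k, add_comm b₂ k, add_comm b₃ k, add_assoc _ b₁,
    add_assoc _ b₂, add_assoc _ b₃]
  simp only [div_eq_mul_inv, mul_inv]
  ring

theorem eulerCoeff_nonneg {a b₁ b₂ b₃ d₁ d₂ d₃ : ℝ} (ha : 0 < a) (hb₁ : 0 < b₁)
    (hb₂ : 0 < b₂) (hb₃ : 0 < b₃) (hd₁ : 0 < d₁) (hd₂ : 0 < d₂) (hd₃ : 0 < d₃) (k : ℕ) :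
    0 ≤ eulerCoeff a b₁ b₂ b₃ d₁ d₂ d₃ k := by
  have hG : ∀ {x : ℝ}, 0 < x → 0 < Real.Gamma x := Real.Gamma_pos_of_pos
  have h0 := hG (show 0 < a + k by positivity)
  have h1 := hG (show 0 < b₁ + k by positivity)
  have h2 := hG (show 0 < b₂ + k by positivity)
  have h3 := hG (show 0 < b₃ + k by positivity)
  have h4 := hG (show 0 < b₁ + k + d₁ by positivity)
  have h5 := hG (show 0 < b₂ + k + d₂ by positivity)
  have h6 := hG (show 0 < b₃ + k + d₃ by positivity)
  have h7 := hG hd₁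
  have h8 := hG hd₂
  have h9 := hG hd₃
  unfold eulerCoeff
  positivity

theorem Fstar_eq_tsum_eulerCoeff {a b₁ b₂ b₃ d₁ d₂ d₃ : ℝ} (ha : 0 < a) (ha' : a < 1)
    (hb₁ : 0 < b₁) (hb₁' : b₁ < 1) (hb₂ : 0 < b₂) (hb₂' : b₂ < 1) (hb₃ : 0 < b₃) (hb₃' : b₃ < 1)
    (hd₁ : 0 < d₁) (hd₂ : 0 < d₂) (hd₃ : 0 < d₃) (hd : d₁ + d₂ + d₃ = 1 + a) :
    ∃ S : ℝ, 0 ≤ S ∧ ∑' k : ℕ, ENNReal.ofReal (eulerCoeff a b₁ b₂ b₃ d₁ d₂ d₃ k) =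
      ENNReal.ofReal S ∧
      Fstar a b₁ b₂ b₃ ↑(b₁ + d₁) ↑(b₂ + d₂) ↑(b₃ + d₃) *
        ((Real.Gamma d₁ * Real.Gamma d₂ * Real.Gamma d₃ : ℝ) : ℂ) = S := by
  have hn := eulerCoeff_nonneg ha hb₁ hb₂ hb₃ hd₁ hd₂ hd₃
  have hs : Summable (eulerCoeff a b₁ b₂ b₃ d₁ d₂ d₃) := by
    rw [← summable_ofReal]
    simp only [ofReal_eulerCoeff]
    refine (summable_Fstar (Sn_ofReal_ne_zero ha ha') (Sn_ofReal_ne_zero hb₁ hb₁')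
      (Sn_ofReal_ne_zero hb₂ hb₂') (Sn_ofReal_ne_zero hb₃ hb₃') ?_).mul_right _
    norm_cast
    linarith
  refine ⟨∑' k, eulerCoeff a b₁ b₂ b₃ d₁ d₂ d₃ k, tsum_nonneg hn,
    (ENNReal.ofReal_tsum_of_nonneg hn hs).symm, ?_⟩
  rw [ofReal_tsum, Fstar, ← tsum_mul_right]
  simp only [ofReal_eulerCoeff]

/-- The two-term relation for the sum of two contiguous Saalschützian series, at real parameters. -/
theorem Fstar_two_term_ofReal {a b₁ b₂ b₃ c₁ c₂ c₃ d₁ d₂ d₃ : ℝ} (ha : 0 < a) (hb₁ : 0 < b₁)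
    (hb₂ : 0 < b₂) (hb₃ : 0 < b₃) (hc₁ : 0 < c₁) (hc₂ : 0 < c₂) (hc₃ : 0 < c₃) (hd₁ : 0 < d₁)
    (hd₂ : 0 < d₂) (hd₃ : 0 < d₃) (h₁ : b₁ + c₁ + d₁ = 1 + a) (h₂ : b₂ + c₂ + d₂ = 1 + a)
    (h₃ : b₃ + c₃ + d₃ = 1 + a) (hd : d₁ + d₂ + d₃ = 1 + a) (hb : b₃ < b₂ + d₂) (hc : b₁ < b₃ + d₃)
    (ha' : a < 1) (hb₁' : b₁ < 1) (hb₂' : b₂ < 1) (hb₃' : b₃ < 1) (hc₁' : c₁ < 1) (hc₂' : c₂ < 1)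
    (hc₃' : c₃ < 1) (hd₁' : d₁ < 1) (hd₂' : d₂ < 1) (hb' : b₂ + d₂ < 1 + b₃)
    (hc' : b₃ + d₃ < 1 + b₁) :
    (Real.Gamma (b₂ + d₂ - b₃) * Real.Gamma (b₃ + d₃ - b₁) * Real.Gamma d₁ * Real.Gamma d₂ : ℝ) *
      (Fstar a b₁ b₂ b₃ ↑(b₁ + d₁) ↑(b₂ + d₂) ↑(b₃ + d₃) +
        Fstar a c₁ c₂ c₃ ↑(c₁ + d₁) ↑(c₂ + d₂) ↑(c₃ + d₃)) =
    (Real.Gamma b₂ * Real.Gamma c₁ * Real.Gamma c₃ * Real.Gamma b₃ : ℝ) *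
      (Fstar a b₁ ↑(b₂ + d₂ - b₃) d₂ ↑(b₁ + c₃) ↑(b₂ + d₂ - b₃ + b₃) ↑(d₂ + d₃) +
        Fstar a ↑(b₃ + d₃ - b₁) c₂ d₁ ↑(b₃ + d₃ - b₁ + c₃) ↑(c₂ + b₃) ↑(d₁ + d₃)) := by
  have key := tsum_eulerCoeff_two_term ha hb₁ hb₂ hb₃ hc₁ hc₂ hc₃ hd₁ hd₂ hd₃ h₁ h₂ h₃ hd hb hc
  obtain ⟨S₁, p₁, q₁, r₁⟩ := Fstar_eq_tsum_eulerCoeff ha ha' hb₁ hb₁' hb₂ hb₂' hb₃ hb₃' hd₁ hd₂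
    hd₃ hd
  obtain ⟨S₂, p₂, q₂, r₂⟩ := Fstar_eq_tsum_eulerCoeff ha ha' hc₁ hc₁' hc₂ hc₂' hc₃ hc₃' hd₁ hd₂
    hd₃ hd
  obtain ⟨S₃, p₃, q₃, r₃⟩ := Fstar_eq_tsum_eulerCoeff (d₁ := c₃) (d₂ := b₃) ha ha' hb₁ hb₁'
    (sub_pos.2 hb) (by linarith) hd₂ hd₂' hc₃ hb₃ hd₃ (by linarith)
  obtain ⟨S₄, p₄, q₄, r₄⟩ := Fstar_eq_tsum_eulerCoeff (d₁ := c₃) (d₂ := b₃) ha ha' (sub_pos.2 hc)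
    (by linarith) hc₂ hc₂' hd₁ hd₁' hc₃ hb₃ hd₃ (by linarith)
  have hG : ∀ {x : ℝ}, 0 < x → 0 < Real.Gamma x := Real.Gamma_pos_of_pos
  have g₁ := hG (sub_pos.2 hb)
  have g₂ := hG (sub_pos.2 hc)
  have g₃ := hG hb₂
  have g₄ := hG hc₁
  have g₅ := hG hd₃
  rw [q₁, q₂, q₃, q₄, ← ENNReal.ofReal_add p₁ p₂, ← ENNReal.ofReal_add p₃ p₄,
    ← ENNReal.ofReal_mul (by positivity), ← ENNReal.ofReal_mul (by positivity),
    ENNReal.ofReal_eq_ofReal_iff (by positivity) (by positivity)] at key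
  have key' := congrArg (fun x : ℝ => (x : ℂ)) key
  simp only [ofReal_mul, ofReal_add, ← r₁, ← r₂, ← r₃, ← r₄] at key'
  have g₅' : (Real.Gamma d₃ : ℂ) ≠ 0 := by exact_mod_cast g₅.ne'
  apply mul_left_cancel₀ g₅'
  simp only [ofReal_mul, ofReal_add]
  linear_combination key'

open Filter Topology in
theorem eq_zero_of_eq_zero_on_Ioo {h : ℂ → ℂ} (hh : Differentiable ℂ h) {δ : ℝ} (hδ : 0 < δ)
    (h0 : ∀ t : ℝ, 0 < t → t < δ → h t = 0) (z : ℂ) : h z = 0 := by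
  have ha : AnalyticOnNhd ℂ h Set.univ := fun w _ => hh.analyticAt w
  refine ha.eqOn_zero_of_preconnected_of_frequently_eq_zero isPreconnected_univ
    (Set.mem_univ (0 : ℂ)) ?_ (Set.mem_univ z)
  have ht : Tendsto (fun t : ℝ => (t : ℂ)) (𝓝[>] 0) (𝓝[≠] 0) := by
    refine tendsto_nhdsWithin_iff.2 ⟨?_, ?_⟩
    · exact (continuous_ofReal.tendsto' 0 0 ofReal_zero).mono_left nhdsWithin_le_nhds
    · filter_upwards [self_mem_nhdsWithin] with t ht
      simpa using (Set.mem_Ioi.1 ht).ne'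
  refine ht.frequently (Eventually.frequently ?_)
  filter_upwards [Ioo_mem_nhdsGT hδ] with t ht
  exact h0 t ht.1 ht.2

/-- A function that is entire on every complex line and vanishes on a real box vanishes. -/
theorem eq_zero_of_eq_zero_on_real_box {n : ℕ} {D : (Fin n → ℂ) → ℂ} (p₀ : Fin n → ℂ) {ε : ℝ}
    (hε : 0 < ε) (hD : ∀ p v : Fin n → ℂ, Differentiable ℂ fun z : ℂ => D fun i => p i + z * v i)
    (h0 : ∀ r : Fin n → ℝ, (∀ i, |r i| < ε) → D (fun i => p₀ i + r i) = 0) (q : Fin n → ℂ) :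
    D q = 0 := by
  have hreal : ∀ r : Fin n → ℝ, D (fun i => p₀ i + r i) = 0 := by
    intro r
    have hM : 0 < 1 + ∑ i, |r i| := by positivity
    have := eq_zero_of_eq_zero_on_Ioo (hD p₀ fun i => r i) (div_pos hε hM) (fun t t0 t1 => by
      have := h0 (fun i => t * r i) fun i => by
        rw [abs_mul, abs_of_pos t0]
        rw [lt_div_iff₀ hM] at t1
        have hi : |r i| ≤ ∑ i, |r i| :=
          Finset.single_le_sum (f := fun i => |r i|)
            (fun j _ => abs_nonneg (r j)) (Finset.mem_univ i)
        nlinarith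
      simpa using this) 1
    simpa using this
  have := eq_zero_of_eq_zero_on_Ioo (hD (fun i => p₀ i + (q i - p₀ i).re)
    fun i => (q i - p₀ i).im) one_pos (fun t _ _ => by
      have := hreal fun i => (q i - p₀ i).re + t * (q i - p₀ i).im
      rw [← this]
      congr 1
      ext i
      push_cast
      ring) I
  rw [← this]
  congr 1
  ext i
  rw [add_assoc, mul_comm I, re_add_im]
  ring

theorem differentiable_Sn : Differentiable ℂ Sn := by
  unfold Sn
  fun_prop

/-- An entire multiple of `Kf`. -/
def entireK (a b c d e f g : ℂ) : ℂ :=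
  (bilatF a b c d e f g 0 * (Sn (1 + a - e) * Sn (1 + a - f) * Sn (1 + a - g)) +
    bilatF a b c d e f g (-a) * (Sn b * Sn c * Sn d)) *
  ((Gamma b)⁻¹ * (Gamma c)⁻¹ * (Gamma d)⁻¹ *
    ((Gamma (1 + a - e))⁻¹ * (Gamma (1 + a - f))⁻¹ * (Gamma (1 + a - g))⁻¹))

theorem differentiable_entireK {a b c d e f g : ℂ → ℂ} (ha : Differentiable ℂ a)
    (hb : Differentiable ℂ b) (hc : Differentiable ℂ c) (hd : Differentiable ℂ d)
    (he : Differentiable ℂ e) (hf : Differentiable ℂ f) (hg : Differentiable ℂ g)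
    (h : ∀ z, e z + f z + g z = a z + b z + c z + d z + 1) :
    Differentiable ℂ fun z => entireK (a z) (b z) (c z) (d z) (e z) (f z) (g z) := by
  have hB : ∀ {T : ℂ → ℂ}, Differentiable ℂ T → Differentiable ℂ fun z =>
      bilatF (a z) (b z) (c z) (d z) (e z) (f z) (g z) (T z) := by
    intro T hT
    unfold bilatF
    refine differentiable_bilat_comp ?_ ?_ hT ?_
    · intro j; fin_cases j <;> simp <;> fun_prop
    · intro j; fin_cases j <;> simp <;> fun_prop
    · intro z
      simp only [Fin.sum_univ_four, Matrix.cons_val]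
      linear_combination h z
  have hS : ∀ {u : ℂ → ℂ}, Differentiable ℂ u → Differentiable ℂ fun z => Sn (u z) :=
    fun hu => differentiable_Sn.comp hu
  have hG : ∀ {u : ℂ → ℂ}, Differentiable ℂ u → Differentiable ℂ fun z => (Gamma (u z))⁻¹ :=
    fun hu => differentiable_one_div_Gamma.comp hu
  have hγ : ∀ {u : ℂ → ℂ}, Differentiable ℂ u → Differentiable ℂ fun z => 1 + a z - u z :=
    fun hu => (ha.const_add 1).sub hu
  unfold entireK
  exact (((hB (differentiable_const 0)).mul (((hS (hγ he)).mul (hS (hγ hf))).mul (hS (hγ hg)))).add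
    ((hB ha.neg).mul (((hS hb).mul (hS hc)).mul (hS hd)))).mul
    ((((hG hb).mul (hG hc)).mul (hG hd)).mul (((hG (hγ he)).mul (hG (hγ hf))).mul (hG (hγ hg))))

theorem pi_pow_mul_entireK {a b c d e f g : ℂ} (ha : Sn a ≠ 0) (hb : Sn b ≠ 0) (hc : Sn c ≠ 0)
    (hd : Sn d ≠ 0) (he : Sn (1 + a - e) ≠ 0) (hf : Sn (1 + a - f) ≠ 0) (hg : Sn (1 + a - g) ≠ 0) :
    Real.pi ^ 4 * entireK a b c d e f g =
      Sn a * (Sn b * Sn c * Sn d) * (Sn (1 + a - e) * Sn (1 + a - f) * Sn (1 + a - g)) *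
      (Fstar a b c d e f g +
        Fstar a (1 + a - e) (1 + a - f) (1 + a - g) (1 + a - b) (1 + a - c) (1 + a - d)) *
      ((Gamma b)⁻¹ * (Gamma c)⁻¹ * (Gamma d)⁻¹ *
        ((Gamma (1 + a - e))⁻¹ * (Gamma (1 + a - f))⁻¹ * (Gamma (1 + a - g))⁻¹)) := by
  have h1 := Fstar_eq_bilatF a b c d e f g ha hb hc hd
  have h2 := Fstar_eq_bilatF_neg a b c d e f g ha he hf hg
  rw [entireK]
  linear_combination (-(Sn (1 + a - e) * Sn (1 + a - f) * Sn (1 + a - g)) * h1 -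
    (Sn b * Sn c * Sn d) * h2) * ((Gamma b)⁻¹ * (Gamma c)⁻¹ * (Gamma d)⁻¹ *
        ((Gamma (1 + a - e))⁻¹ * (Gamma (1 + a - f))⁻¹ * (Gamma (1 + a - g))⁻¹))

theorem Fstar_swap_left (a b c d e f g : ℂ) : Fstar a b c d e f g = Fstar a c b d e f g :=
  tsum_congr fun k => by rw [mul_right_comm (Gamma (k + a))]

theorem Fstar_swap_left' (a b c d e f g : ℂ) : Fstar a b c d e f g = Fstar a b d c e f g :=
  tsum_congr fun k => by rw [mul_right_comm (Gamma (k + a) * Gamma (k + b))]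

theorem Fstar_swap_right (a b c d e f g : ℂ) : Fstar a b c d e f g = Fstar a b c d f e g :=
  tsum_congr fun k => by rw [mul_right_comm (k.factorial : ℂ)]

theorem Fstar_swap_right' (a b c d e f g : ℂ) : Fstar a b c d e f g = Fstar a b c d e g f :=
  tsum_congr fun k => by rw [mul_right_comm (k.factorial * Gamma (k + e))]

theorem entireK_eq_of_box {a b c d e f : ℝ} (ha : |a - 1 / 2| < 1 / 20) (hb : |b - 1 / 2| < 1 / 20)
    (hc : |c - 1 / 2| < 1 / 20) (hd : |d - 1 / 2| < 1 / 20) (he : |e - 1| < 1 / 20)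
    (hf : |f - 1| < 1 / 20) {g : ℝ} (hg : g = a + b + c + d + 1 - e - f) :
    entireK a b c d e f g * (Sn (f - b) * Sn (f - d) * (Sn (g - c) * Sn (e - c))) =
      entireK a c (f - b) (f - d) f (1 + a + c - g) (1 + a + c - e) *
        (Sn b * Sn d * (Sn (1 + a - e) * Sn (1 + a - g))) := by
  rw [abs_lt] at ha hb hc hd he hf
  obtain ⟨ha, ha'⟩ := ha
  obtain ⟨hb, hb'⟩ := hb
  obtain ⟨hc, hc'⟩ := hc
  obtain ⟨hd, hd'⟩ := hd
  obtain ⟨he, he'⟩ := he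
  obtain ⟨hf, hf'⟩ := hf
  have key := Fstar_two_term_ofReal (a := a) (b₁ := c) (b₂ := b) (b₃ := d) (c₁ := 1 + a - e)
    (c₂ := 1 + a - f) (c₃ := 1 + a - g) (d₁ := e - c) (d₂ := f - b) (d₃ := g - d)
    (by linarith) (by linarith) (by linarith) (by linarith) (by linarith) (by linarith)
    (by linarith) (by linarith) (by linarith) (by linarith) (by linarith) (by linarith)
    (by linarith) (by linarith) (by linarith) (by linarith) (by linarith) (by linarith)
    (by linarith) (by linarith) (by linarith) (by linarith) (by linarith) (by linarith)
    (by linarith) (by linarith) (by linarith)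
  have hS : ∀ {x : ℝ} {y : ℂ}, (x : ℂ) = y → 0 < x → x < 1 → Sn y ≠ 0 := by
    rintro x _ rfl h0 h1
    exact Sn_ofReal_ne_zero h0 h1
  have hG : ∀ {x : ℝ} {y : ℂ}, (x : ℂ) = y → 0 < x → Gamma y ≠ 0 := by
    rintro x _ rfl h0
    rw [Gamma_ofReal]
    exact_mod_cast (Real.Gamma_pos_of_pos h0).ne'
  have s₁ := hS (x := f - b) (by push_cast; rfl) (by linarith) (by linarith)
  have s₂ := hS (x := f - d) (by push_cast; rfl) (by linarith) (by linarith)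
  have s₃ := hS (x := g - c) (by push_cast; rfl) (by linarith) (by linarith)
  have s₄ := hS (x := e - c) (by push_cast; rfl) (by linarith) (by linarith)
  have t₂ := hS (x := 1 + a - f) (by push_cast; rfl) (by linarith) (by linarith)
  have tc := hS (x := c) rfl (by linarith) (by linarith)
  have ta := hS (x := a) rfl (by linarith) (by linarith)
  have g₁ := hG (x := f - b) (by push_cast; rfl) (by linarith)
  have g₂ := hG (x := f - d) (by push_cast; rfl) (by linarith)
  have g₃ := hG (x := g - c) (by push_cast; rfl) (by linarith)
  have g₄ := hG (x := e - c) (by push_cast; rfl) (by linarith)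
  have g₅ := hG (x := b) rfl (by linarith)
  have g₆ := hG (x := d) rfl (by linarith)
  have g₇ := hG (x := 1 + a - e) (by push_cast; rfl) (by linarith)
  have g₈ := hG (x := 1 + a - g) (by push_cast; rfl) (by linarith)
  have h1 := pi_pow_mul_entireK (a := a) (b := b) (c := c) (d := d) (e := e) (f := f) (g := g)
    ta (hS rfl (by linarith) (by linarith)) tc (hS rfl (by linarith) (by linarith))
    (hS (x := 1 + a - e) (by push_cast; rfl) (by linarith) (by linarith)) t₂
    (hS (x := 1 + a - g) (by push_cast; rfl) (by linarith) (by linarith))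
  have h2 := pi_pow_mul_entireK (a := a) (b := c) (c := f - b) (d := f - d) (e := f)
    (f := 1 + a + c - g) (g := 1 + a + c - e) ta tc s₁ s₂ t₂
    (by rwa [show (1 + a - (1 + a + c - g) : ℂ) = g - c by ring])
    (by rwa [show (1 + a - (1 + a + c - e) : ℂ) = e - c by ring])
  have hgC : (g : ℂ) = a + b + c + d + 1 - e - f := by rw [hg]; push_cast; ring
  have q₁ : Fstar a c b d ↑(c + (e - c)) ↑(b + (f - b)) ↑(d + (g - d)) = Fstar a b c d e f g := by
    rw [Fstar_swap_left]
    congr 1 <;> push_cast <;> ring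
  have q₂ : Fstar a ↑(1 + a - e) ↑(1 + a - f) ↑(1 + a - g) ↑(1 + a - e + (e - c))
      ↑(1 + a - f + (f - b)) ↑(1 + a - g + (g - d)) =
      Fstar a (1 + a - e) (1 + a - f) (1 + a - g) (1 + a - b) (1 + a - c) (1 + a - d) := by
    rw [Fstar_swap_right]
    congr 1 <;> push_cast <;> ring
  have q₃ : Fstar a c ↑(b + (f - b) - d) ↑(f - b) ↑(c + (1 + a - g)) ↑(b + (f - b) - d + d)
      ↑(f - b + (g - d)) =
      Fstar a c (f - b) (f - d) f (1 + a + c - g) (1 + a + c - e) := by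
    rw [Fstar_swap_right, Fstar_swap_left']
    congr 1 <;> push_cast <;> first | ring1 | linear_combination hgC
  have q₄ : Fstar a ↑(d + (g - d) - c) ↑(1 + a - f) ↑(e - c) ↑(d + (g - d) - c + (1 + a - g))
      ↑(1 + a - f + d) ↑(e - c + (g - d)) =
      Fstar a (1 + a - f) (g - c) (e - c) (1 + a - c) (1 + a - (f - b)) (1 + a - (f - d)) := by
    rw [Fstar_swap_right', Fstar_swap_left]
    congr 1 <;> push_cast <;> first | ring1 | linear_combination hgC
  rw [show (1 + a - (1 + a + c - g) : ℂ) = g - c by ring,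
    show (1 + a - (1 + a + c - e) : ℂ) = e - c by ring] at h2
  rw [q₁, q₂, q₃, q₄, show b + (f - b) - d = f - d by ring, show d + (g - d) - c = g - c by ring]
    at key
  simp only [ofReal_mul, ← Gamma_ofReal, ofReal_sub, ofReal_add, ofReal_one] at key
  have hpi : (Real.pi : ℂ) ^ 4 ≠ 0 := by exact_mod_cast pow_ne_zero 4 Real.pi_ne_zero
  refine mul_left_cancel₀ hpi ?_
  rw [← mul_assoc (Real.pi ^ 4 : ℂ), h1, ← mul_assoc (Real.pi ^ 4 : ℂ), h2]
  generalize Fstar a b c d e f g + _ = F at key ⊢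
  generalize Fstar a c (f - b) (f - d) f (1 + a + c - g) (1 + a + c - e) + _ = F' at key ⊢
  have hF : F * ((Gamma b)⁻¹ * (Gamma d)⁻¹ * (Gamma (1 + a - e))⁻¹ * (Gamma (1 + a - g))⁻¹) =
      F' * ((Gamma (f - b))⁻¹ * (Gamma (f - d))⁻¹ * (Gamma (g - c))⁻¹ * (Gamma (e - c))⁻¹) := by
    field_simp
    linear_combination key
  linear_combination (Sn a * (Sn b * Sn c * Sn d) * (Sn (1 + a - e) * Sn (1 + a - f) *
    Sn (1 + a - g)) * (Sn (f - b) * Sn (f - d) * (Sn (g - c) * Sn (e - c)))) *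
    ((Gamma c)⁻¹ * (Gamma (1 + a - f))⁻¹) * hF

/-- The two-term relation for `entireK`, at all complex parameters. -/
theorem entireK_two_term (a b c d e f g : ℂ) (hg : e + f + g = a + b + c + d + 1) :
    entireK a b c d e f g * (Sn (f - b) * Sn (f - d) * (Sn (g - c) * Sn (e - c))) =
      entireK a c (f - b) (f - d) f (1 + a + c - g) (1 + a + c - e) *
        (Sn b * Sn d * (Sn (1 + a - e) * Sn (1 + a - g))) := by
  obtain rfl : g = a + b + c + d + 1 - e - f := by linear_combination hg
  have h := eq_zero_of_eq_zero_on_real_box (D := fun p : Fin 6 → ℂ =>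
    (fun a b c d e f g : ℂ => entireK a b c d e f g *
        (Sn (f - b) * Sn (f - d) * (Sn (g - c) * Sn (e - c))) -
      entireK a c (f - b) (f - d) f (1 + a + c - g) (1 + a + c - e) *
        (Sn b * Sn d * (Sn (1 + a - e) * Sn (1 + a - g))))
      (p 0) (p 1) (p 2) (p 3) (p 4) (p 5) (p 0 + p 1 + p 2 + p 3 + 1 - p 4 - p 5))
    ![1 / 2, 1 / 2, 1 / 2, 1 / 2, 1, 1] (ε := 1 / 20) (by norm_num) ?_ ?_ ![a, b, c, d, e, f]
  · exact sub_eq_zero.1 h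
  · intro p v
    have hS : ∀ {u : ℂ → ℂ}, Differentiable ℂ u → Differentiable ℂ fun z => Sn (u z) :=
      fun hu => differentiable_Sn.comp hu
    refine ((differentiable_entireK ?_ ?_ ?_ ?_ ?_ ?_ ?_ ?_).mul (((hS ?_).mul (hS ?_)).mul
      ((hS ?_).mul (hS ?_)))).sub ((differentiable_entireK ?_ ?_ ?_ ?_ ?_ ?_ ?_ ?_).mul
      (((hS ?_).mul (hS ?_)).mul ((hS ?_).mul (hS ?_))))
    all_goals first | fun_prop | (intro z; ring)
  · intro r hr
    have key := entireK_eq_of_box (a := 1 / 2 + r 0) (b := 1 / 2 + r 1) (c := 1 / 2 + r 2)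
      (d := 1 / 2 + r 3) (e := 1 + r 4) (f := 1 + r 5) (by simpa using hr 0) (by simpa using hr 1)
      (by simpa using hr 2) (by simpa using hr 3) (by simpa using hr 4) (by simpa using hr 5) rfl
    push_cast at key
    exact sub_eq_zero.2 key

/-- `x - x⁻¹`, that is `2 i sin θ` at `x = exp (iθ)`. -/
def subInv (x : ℂ) : ℂ := x - x⁻¹

/-- The trigonometric form of the three-term relation, in exponential variables, with weights. -/
def sineForm (A B C D E G w₀ w₁ w₂ w₃ w₄ w₅ : ℂ) : ℂ :=
  (subInv (A * B / E) * subInv (G / (C * D)) * subInv (G / E) -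
      subInv (A * B / E ^ 2) * subInv (G / D) * subInv (G / C)) *
    (w₀ * -subInv (B * C * D / (E * G)) * (subInv (G / C) * subInv (E / C)) +
      w₁ * -subInv (A * C * D / (E * G)) * (subInv C * -subInv (A * B * C / (E * G)))) *
      (subInv (G / B) * subInv (G / A)) +
  (subInv E * subInv (A * D / G) * subInv (G * E / (B * C)) -
      subInv (A * E / B) * subInv (E / C) * subInv D) *
    (w₂ * -subInv (A * B * D / (E * G)) * (subInv C * subInv (G / A)) +
      w₃ * subInv (G / D) * (subInv (E / C) * subInv (G / B))) *
      (-subInv (A * B * C / (E * G)) * subInv (G / C)) +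
  (subInv (B / A) * subInv (C / A) * subInv (D / A) +
      subInv (E / A ^ 2) * -subInv (B * C * D / (E * G)) * subInv (G / A)) *
    (w₄ * subInv D * (-subInv (A * B * C / (E * G)) * subInv (G / B)) +
      w₅ * subInv (E / D) * (subInv (G / C) * subInv (G / A))) * (subInv C * subInv (E / C))

theorem sineForm_const {A B C D E G : ℂ} (hA : A ≠ 0) (hB : B ≠ 0) (hC : C ≠ 0) (hD : D ≠ 0)
    (hE : E ≠ 0) (hG : G ≠ 0) : sineForm A B C D E G 1 1 1 1 1 1 = 0 := by
  simp only [sineForm, subInv]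
  field_simp
  ring

theorem sineForm_pos {A B C D E G : ℂ} (hA : A ≠ 0) (hB : B ≠ 0) (hC : C ≠ 0) (hD : D ≠ 0)
    (hE : E ≠ 0) (hG : G ≠ 0) : sineForm A B C D E G 1 (A⁻¹ ^ 2) ((E / (A * C)) ^ 2) (C⁻¹ ^ 2)
      ((G / (A * C)) ^ 2) ((E * G / (A * B * C)) ^ 2) = 0 := by
  simp only [sineForm, subInv]
  field_simp
  ring

theorem sineForm_neg {A B C D E G : ℂ} (hA : A ≠ 0) (hB : B ≠ 0) (hC : C ≠ 0) (hD : D ≠ 0)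
    (hE : E ≠ 0) (hG : G ≠ 0) : sineForm A B C D E G 1 (A⁻¹ ^ 2)⁻¹ ((E / (A * C)) ^ 2)⁻¹ (C⁻¹ ^ 2)⁻¹
      ((G / (A * C)) ^ 2)⁻¹ ((E * G / (A * B * C)) ^ 2)⁻¹ = 0 := by
  simp only [sineForm, subInv]
  field_simp
  ring

theorem Sn_eq_subInv {x P : ℂ} (h : exp (Real.pi * I * x) = P) : Sn x = (2 * I)⁻¹ * subInv P := by
  rw [Sn, sin, ← h, subInv, ← exp_neg]
  rw [show -(Real.pi * x) * I = -(Real.pi * I * x) by ring,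
    show Real.pi * x * I = Real.pi * I * x by ring]
  field_simp
  linear_combination (exp (-(Real.pi * I * x)) - exp (Real.pi * I * x)) * I_sq

theorem Sn_add_one (x : ℂ) : Sn (x + 1) = -Sn x := by
  rw [Sn, Sn, mul_add, mul_one, sin_add_pi]

theorem Sn_neg (x : ℂ) : Sn (-x) = -Sn x := by
  rw [Sn, Sn, mul_neg, sin_neg]

theorem Sn_one_sub (x : ℂ) : Sn (1 - x) = Sn x := by
  rw [sub_eq_neg_add, Sn_add_one, Sn_neg, neg_neg]

theorem Sn_eq_neg_subInv {x P : ℂ} (h : exp (Real.pi * I * (x - 1)) = P) :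
    Sn x = (2 * I)⁻¹ * -subInv P := by
  rw [show x = x - 1 + 1 by ring, Sn_add_one, Sn_eq_subInv h, mul_neg]

theorem Sn_eq_neg_subInv' {x P : ℂ} (h : exp (Real.pi * I * (x + 1)) = P) :
    Sn x = (2 * I)⁻¹ * -subInv P := by
  rw [← neg_neg (Sn x), ← Sn_add_one, Sn_eq_subInv h, mul_neg]

theorem three_term_of_laurent {a b c d e f g : ℂ} (h : e + f + g = a + b + c + d + 1) {W : ℂ → ℂ}
    (hW : ∃ α β γ : ℂ, ∀ s, W s =
      α * exp (-(2 * Real.pi * I * s)) + β + γ * exp (2 * Real.pi * I * s)) :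
    (Sn (b - (e - a)) * Sn (1 + b - f - (e - a)) * Sn (g - a - (e - a)) +
        Sn (1 + b - a - 2 * (e - a)) * Sn (1 + b + c - f - (e - a)) *
          Sn (1 + b + d - f - (e - a))) *
      (W 0 * Sn (f - a) * (Sn (g - c) * Sn (e - c)) +
        W (-a) * Sn (f - b) * (Sn c * Sn (f - d))) * (Sn (g - b) * Sn (g - a)) +
    (Sn (b - (1 + b - e)) * Sn (f - c - (1 + b - e)) * Sn (g - c - (1 + b - e)) +
        Sn (1 + a + b - e - 2 * (1 + b - e)) * Sn (1 + b - c - (1 + b - e)) *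
          Sn (1 + b + d - e - (1 + b - e))) *
      (W (e - a - c) * Sn (f - c) * (Sn c * Sn (g - a)) +
        W (-c) * Sn (g - d) * (Sn (e - c) * Sn (g - b))) * (Sn (f - d) * Sn (g - c)) +
    (Sn (b - a) * Sn (c - a) * Sn (d - a) + Sn (e - 2 * a) * Sn (f - a) * Sn (g - a)) *
      (W (g - a - c) * Sn d * (Sn (f - d) * Sn (g - b)) +
        W (d - f) * Sn (e - d) * (Sn (g - c) * Sn (g - a))) * (Sn c * Sn (e - c)) = 0 := by
  obtain ⟨α, β, γ, hW⟩ := hW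
  obtain rfl : f = a + b + c + d + 1 - e - g := by linear_combination h
  obtain ⟨u, hu⟩ : ∃ u : ℂ → ℂ, ∀ x, u x = exp (Real.pi * I * x) := ⟨_, fun _ => rfl⟩
  have hu0 : ∀ x, u x ≠ 0 := fun x => by rw [hu]; exact exp_ne_zero _
  have hm : ∀ x y, u x * u y = u (x + y) := fun x y => by rw [hu, hu, hu, ← exp_add, mul_add]
  have hd : ∀ x y, u x / u y = u (x - y) := fun x y => by rw [hu, hu, hu, ← exp_sub, mul_sub]
  have hp : ∀ x, u x ^ 2 = u (x + x) := fun x => by rw [sq, hm]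
  have h0 := sineForm_const (hu0 a) (hu0 b) (hu0 c) (hu0 d) (hu0 e) (hu0 g)
  have h1 := sineForm_pos (hu0 a) (hu0 b) (hu0 c) (hu0 d) (hu0 e) (hu0 g)
  have h2 := sineForm_neg (hu0 a) (hu0 b) (hu0 c) (hu0 d) (hu0 e) (hu0 g)
  have hE : ∀ {s Q}, Q = u s ^ 2 → W s = α * Q⁻¹ + β + γ * Q := by
    rintro s _ rfl
    rw [hW, exp_neg, hp, hu, show Real.pi * I * (s + s) = 2 * Real.pi * I * s by ring]
  have e0 : W 0 = α * 1 + β + γ * 1 := by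
    rw [hW]
    simp
  have e1 : W (-a) = _ := hE (Q := (u a)⁻¹ ^ 2) (by
    rw [hu, hu, ← exp_neg]; congr 2; ring)
  have e2 : W (e - a - c) = _ := hE (Q := (u e / (u a * u c)) ^ 2) (by
    simp only [hm, hd]; congr 2; ring)
  have e3 : W (-c) = _ := hE (Q := (u c)⁻¹ ^ 2) (by
    rw [hu, hu, ← exp_neg]; congr 2; ring)
  have e4 : W (g - a - c) = _ := hE (Q := (u g / (u a * u c)) ^ 2) (by
    simp only [hm, hd]; congr 2; ring)
  have e5 : W (d - (a + b + c + d + 1 - e - g)) = _ :=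
    hE (Q := (u e * u g / (u a * u b * u c)) ^ 2) (by
      rw [show u (d - (a + b + c + d + 1 - e - g)) = -u (e + g - (a + b + c)) by
        rw [hu, hu, ← mul_neg_one, ← exp_pi_mul_I, show
          Real.pi * I * (d - (a + b + c + d + 1 - e - g)) =
            Real.pi * I * (e + g - (a + b + c)) - Real.pi * I by ring, exp_sub, exp_pi_mul_I]
        ring]
      simp only [hm, hd, neg_sq])
  have hs : ∀ {x y P}, u y = P → y = x → Sn x = (2 * I)⁻¹ * subInv P := by
    rintro x _ _ rfl rfl
    exact Sn_eq_subInv (hu _).symm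
  have hs' : ∀ {x y P}, u y = P → y + 1 = x → Sn x = (2 * I)⁻¹ * -subInv P := by
    rintro x y _ rfl rfl
    exact Sn_eq_neg_subInv (by rw [hu, add_sub_cancel_right])
  have hs'' : ∀ {x y P}, u y = P → y - 1 = x → Sn x = (2 * I)⁻¹ * -subInv P := by
    rintro x y _ rfl rfl
    exact Sn_eq_neg_subInv' (by rw [hu, sub_add_cancel])
  set f := a + b + c + d + 1 - e - g with hf
  rw [hs (x := b - (e - a)) (P := u a * u b / u e) (by rw [hm, hd]) (by ring),
    hs (x := 1 + b - f - (e - a)) (P := u g / (u c * u d)) (by rw [hm, hd]) (by rw [hf]; ring),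
    hs (x := g - a - (e - a)) (P := u g / u e) (by rw [hd]) (by ring),
    hs' (x := 1 + b - a - 2 * (e - a)) (P := u a * u b / u e ^ 2) (by rw [hp, hm, hd]) (by ring),
    hs (x := 1 + b + c - f - (e - a)) (P := u g / u d) (by rw [hd]) (by rw [hf]; ring),
    hs (x := 1 + b + d - f - (e - a)) (P := u g / u c) (by rw [hd]) (by rw [hf]; ring),
    hs'' (x := b - (1 + b - e)) (P := u e) rfl (by ring),
    hs (x := f - c - (1 + b - e)) (P := u a * u d / u g) (by rw [hm, hd]) (by rw [hf]; ring),
    hs'' (x := g - c - (1 + b - e)) (P := u g * u e / (u b * u c)) (by rw [hm, hm, hd]) (by ring),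
    hs'' (x := 1 + a + b - e - 2 * (1 + b - e)) (P := u a * u e / u b) (by rw [hm, hd]) (by ring),
    hs (x := 1 + b - c - (1 + b - e)) (P := u e / u c) (by rw [hd]) (by ring),
    hs (x := 1 + b + d - e - (1 + b - e)) (P := u d) rfl (by ring),
    hs (x := b - a) (P := u b / u a) (by rw [hd]) rfl,
    hs (x := c - a) (P := u c / u a) (by rw [hd]) rfl,
    hs (x := d - a) (P := u d / u a) (by rw [hd]) rfl,
    hs (x := e - 2 * a) (P := u e / u a ^ 2) (by rw [hp, hd]) (by ring),
    hs' (x := f - a) (P := u b * u c * u d / (u e * u g)) (by rw [hm, hm, hm, hd])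
      (by rw [hf]; ring),
    hs' (x := f - b) (P := u a * u c * u d / (u e * u g)) (by rw [hm, hm, hm, hd])
      (by rw [hf]; ring),
    hs' (x := f - c) (P := u a * u b * u d / (u e * u g)) (by rw [hm, hm, hm, hd])
      (by rw [hf]; ring),
    hs' (x := f - d) (P := u a * u b * u c / (u e * u g)) (by rw [hm, hm, hm, hd])
      (by rw [hf]; ring),
    hs (x := g - a) (P := u g / u a) (by rw [hd]) rfl,
    hs (x := g - b) (P := u g / u b) (by rw [hd]) rfl,
    hs (x := g - c) (P := u g / u c) (by rw [hd]) rfl,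
    hs (x := g - d) (P := u g / u d) (by rw [hd]) rfl,
    hs (x := e - c) (P := u e / u c) (by rw [hd]) rfl,
    hs (x := e - d) (P := u e / u d) (by rw [hd]) rfl,
    hs (x := c) (P := u c) rfl rfl, hs (x := d) (P := u d) rfl rfl,
    e0, e1, e2, e3, e4, e5]
  simp only [sineForm] at h0 h1 h2
  linear_combination (2 * I)⁻¹ ^ 8 * (α * h2 + β * h0 + γ * h1)

theorem Sn_ne_zero {x : ℂ} (h : ∀ n : ℤ, x ≠ n) : Sn x ≠ 0 := by
  intro h0
  rw [Sn, sin_eq_zero_iff] at h0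
  obtain ⟨n, hn⟩ := h0
  have hpi : (Real.pi : ℂ) ≠ 0 := by exact_mod_cast Real.pi_ne_zero
  refine h n (mul_left_cancel₀ hpi ?_)
  rw [hn, mul_comm]

theorem inv_Gamma_mul_inv_Gamma {x y : ℂ} (h : x + y = 1) :
    (Gamma x)⁻¹ * (Gamma y)⁻¹ = Sn x / Real.pi := by
  obtain rfl : y = 1 - x := by linear_combination h
  rw [← mul_inv, Gamma_mul_Gamma_one_sub, inv_div, Sn]

theorem Kf_swap_left (a b c d e f g : ℂ) : Kf a b c d e f g = Kf a b d c e f g := by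
  rw [Kf, Kf, Fstar_swap_left', Fstar_swap_right' a (1 + a - e)]
  ring

theorem Kf_swap_right (a b c d e f g : ℂ) : Kf a b c d e f g = Kf a b c d e g f := by
  rw [Kf, Kf, Fstar_swap_right', Fstar_swap_left' a (1 + a - e)]
  ring

/-- The function `Kf` in terms of two values of a bilateral series. -/
theorem Kf_eq_bilatF {a b c d e f g : ℂ} (h : e + f + g = a + b + c + d + 1) (ha : Sn a ≠ 0)
    (hb : Sn b ≠ 0) (hc : Sn c ≠ 0) (hd : Sn d ≠ 0) (he : Sn (1 + a - e) ≠ 0)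
    (hf : Sn (1 + a - f) ≠ 0) (hg : Sn (1 + a - g) ≠ 0) (hfb : Sn (f - b) ≠ 0)
    (hfd : Sn (f - d) ≠ 0) (hgc : Sn (g - c) ≠ 0) (hec : Sn (e - c) ≠ 0) :
    Kf a b c d e f g = Real.pi ^ 4 * (Sn a)⁻¹ ^ 2 *
      (bilatF a c (f - b) (f - d) f (1 + a + c - g) (1 + a + c - e) 0 *
          (Sn c * Sn (f - b) * Sn (f - d))⁻¹ +
        bilatF a c (f - b) (f - d) f (1 + a + c - g) (1 + a + c - e) (-a) *
          (Sn (1 + a - f) * Sn (g - c) * Sn (e - c))⁻¹) *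
      ((Gamma a)⁻¹ ^ 2 * (Gamma c)⁻¹ * (Gamma (f - b))⁻¹ * (Gamma (f - d))⁻¹ *
        (Gamma (1 + a - f))⁻¹ * (Gamma (g - c))⁻¹ * (Gamma (e - c))⁻¹) := by
  have h1 := pi_pow_mul_entireK ha hb hc hd he hf hg
  have h2 := entireK_two_term a b c d e f g h
  have h3 : Kf a b c d e f g = (Sn a)⁻¹ * (Gamma a)⁻¹ ^ 2 *
      ((Fstar a b c d e f g +
        Fstar a (1 + a - e) (1 + a - f) (1 + a - g) (1 + a - b) (1 + a - c) (1 + a - d)) *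
      ((Gamma b)⁻¹ * (Gamma c)⁻¹ * (Gamma d)⁻¹ *
        ((Gamma (1 + a - e))⁻¹ * (Gamma (1 + a - f))⁻¹ * (Gamma (1 + a - g))⁻¹))) := by
    rw [Kf]
    simp only [div_eq_mul_inv, mul_inv, inv_pow]
    ring
  rw [h3]
  rw [entireK.eq_1 a c, show 1 + a - (1 + a + c - g) = g - c by ring,
    show 1 + a - (1 + a + c - e) = e - c by ring] at h2
  generalize (Fstar a b c d e f g +
    Fstar a (1 + a - e) (1 + a - f) (1 + a - g) (1 + a - b) (1 + a - c) (1 + a - d)) = F at h1 ⊢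
  generalize (Gamma b)⁻¹ * (Gamma c)⁻¹ * (Gamma d)⁻¹ *
        ((Gamma (1 + a - e))⁻¹ * (Gamma (1 + a - f))⁻¹ * (Gamma (1 + a - g))⁻¹) = Y at h1 ⊢
  generalize entireK a b c d e f g = X at h1 h2
  generalize (Gamma a)⁻¹ = G₀
  generalize (Gamma c)⁻¹ = G₁ at h2 ⊢
  generalize (Gamma (f - b))⁻¹ = G₂ at h2 ⊢
  generalize (Gamma (f - d))⁻¹ = G₃ at h2 ⊢
  generalize (Gamma (1 + a - f))⁻¹ = G₄ at h2 ⊢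
  generalize (Gamma (g - c))⁻¹ = G₅ at h2 ⊢
  generalize (Gamma (e - c))⁻¹ = G₆ at h2 ⊢
  generalize bilatF _ _ _ _ _ _ _ _ = W₀ at h2 ⊢
  generalize bilatF _ _ _ _ _ _ _ _ = W₁ at h2 ⊢
  have hX : F * Y = Real.pi ^ 4 * X / (Sn a * (Sn b * Sn c * Sn d) *
      (Sn (1 + a - e) * Sn (1 + a - f) * Sn (1 + a - g))) := by
    rw [eq_div_iff (by simp [ha, hb, hc, hd, he, hf, hg])]
    linear_combination -h1
  rw [hX, eq_div_of_mul_eq (by simp [hfb, hfd, hgc, hec]) h2]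
  field_simp

theorem bilatF_shift {a b c d e f g : ℂ} (h : e + f + g = a + b + c + d + 1) (t : ℂ) :
    bilatF (e - a) (e - c) (1 + e - g - (e - b)) (1 + e - g - (e - d)) (1 + e - g)
      (1 + (e - a) + (e - c) - (1 + e - f)) (1 + (e - a) + (e - c) - e) t =
    bilatF a c (f - b) (f - d) f (1 + a + c - g) (1 + a + c - e) (e - a - c + t) := by
  obtain rfl : g = a + b + c + d + 1 - e - f := by linear_combination h
  simp only [bilatF, bilat]
  refine tsum_congr fun k => ?_
  have hx : ∀ {x y z w x' y' z' w' : ℂ}, x = y' → y = x' → z = w' → w = z' →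
      (Gamma x)⁻¹ * (Gamma y)⁻¹ * (Gamma z)⁻¹ * (Gamma w)⁻¹ =
      (Gamma x')⁻¹ * (Gamma y')⁻¹ * (Gamma z')⁻¹ * (Gamma w')⁻¹ := by
    rintro x y z w _ _ _ _ rfl rfl rfl rfl
    ring
  have hy : ∀ {x y z w x' y' z' w' : ℂ}, x = w' → y = z' → z = y' → w = x' →
      (Gamma x)⁻¹ * (Gamma y)⁻¹ * (Gamma z)⁻¹ * (Gamma w)⁻¹ =
      (Gamma x')⁻¹ * (Gamma y')⁻¹ * (Gamma z')⁻¹ * (Gamma w')⁻¹ := by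
    rintro x y z w _ _ _ _ rfl rfl rfl rfl
    ring
  rw [bilatTerm_four, bilatTerm_four]
  exact congrArg₂ _ (hx (by ring) (by ring) (by ring) (by ring))
    (hy (by ring) (by ring) (by ring) (by ring))

theorem bilatF_shift' {a b c d e f g : ℂ} (h : e + f + g = a + b + c + d + 1) (t : ℂ) :
    bilatF (1 + b - e) (1 + d - e) (1 + g - e - (1 + a - e)) (1 + g - e - (1 + c - e)) (1 + g - e)
      (1 + (1 + b - e) + (1 + d - e) - (1 + f - e)) (1 + (1 + b - e) + (1 + d - e) - (2 - e)) t =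
    bilatF a c (f - b) (f - d) f (1 + a + c - g) (1 + a + c - e) (g - a - c + t) := by
  obtain rfl : g = a + b + c + d + 1 - e - f := by linear_combination h
  simp only [bilatF, bilat]
  refine tsum_congr fun k => ?_
  have hx : ∀ {x y z w x' y' z' w' : ℂ}, x = w' → y = z' → z = y' → w = x' →
      (Gamma x)⁻¹ * (Gamma y)⁻¹ * (Gamma z)⁻¹ * (Gamma w)⁻¹ =
      (Gamma x')⁻¹ * (Gamma y')⁻¹ * (Gamma z')⁻¹ * (Gamma w')⁻¹ := by
    rintro x y z w _ _ _ _ rfl rfl rfl rfl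
    ring
  have hy : ∀ {x y z w x' y' z' w' : ℂ}, x = z' → y = w' → z = x' → w = y' →
      (Gamma x)⁻¹ * (Gamma y)⁻¹ * (Gamma z)⁻¹ * (Gamma w)⁻¹ =
      (Gamma x')⁻¹ * (Gamma y')⁻¹ * (Gamma z')⁻¹ * (Gamma w')⁻¹ := by
    rintro x y z w _ _ _ _ rfl rfl rfl rfl
    ring
  rw [bilatTerm_four, bilatTerm_four]
  exact congrArg₂ _ (hx (by ring) (by ring) (by ring) (by ring))
    (hy (by ring) (by ring) (by ring) (by ring))

theorem reflection_cancel {p P G Q B X Y s₁ s₂ s₃ : ℂ} (hp : p ≠ 0) (hs : s₁ ≠ 0)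
    (h : P * G = Q * (s₁ / p * (s₂ / p) * (s₃ / p))) :
    P * (B * s₁ * X / p ^ 4) * (p ^ 4 * s₁⁻¹ ^ 2 * Y * G) =
      Q * B / p ^ 3 * (X * (s₂ * s₃ * Y)) := by
  calc _ = P * G * (B * s₁ * X / p ^ 4 * (p ^ 4 * s₁⁻¹ ^ 2 * Y)) := by ring
    _ = _ := by
      rw [h]
      field_simp

theorem hamming444_KKK_relation (a b c d e f g : ℂ)
    (hsaal : e + f + g = a + b + c + d + 1)
    (hint : ∀ i : Fin 7, ∀ n : ℤ, ![a, b, c, d, e, f, g] i ≠ (n : ℂ))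
    (hdiff : ∀ i j : Fin 7, i ≠ j → ∀ n : ℤ,
      ![a, b, c, d, e, f, g] i - ![a, b, c, d, e, f, g] j ≠ (n : ℂ)) :
    Af (1 - a) (e - a) (f - a) (g - a) * Af b (1 + b - e) (1 + b - f) (1 + b - g) *
        B5 (e - a) b (1 + b - f) (g - a) (1 + b - a) (1 + b + c - f) (1 + b + d - f) *
        Kf a b c d e f g +
      Af a (1 + a - e) (f - d) (g - d) * Af b (1 + b - e) (f - c) (g - c) *
        B5 (1 + b - e) b (f - c) (g - c) (1 + a + b - e) (1 + b - c) (1 + b + d - e) *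
        Kf (e - a) (e - b) (e - c) (e - d) e (1 + e - f) (1 + e - g) +
      Af a b c d * Af (e - a) (e - b) (e - c) (e - d) * B5 a b c d e f g *
        Kf (1 + b - e) (1 + a - e) (1 + c - e) (1 + d - e) (2 - e) (1 + f - e) (1 + g - e) = 0 := by
  have hn : ∀ i : Fin 7, Sn (![a, b, c, d, e, f, g] i) ≠ 0 := fun i => Sn_ne_zero (hint i)
  have hn' : ∀ i j : Fin 7, i ≠ j → Sn (![a, b, c, d, e, f, g] i - ![a, b, c, d, e, f, g] j) ≠ 0 :=
    fun i j hij => Sn_ne_zero (hdiff i j hij)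
  have hs : ∀ x y : ℂ, Sn (1 + x - y) = Sn (y - x) := fun x y => by
    rw [← Sn_one_sub (y - x)]
    congr 1
    ring
  have sa : Sn a ≠ 0 := hn 0
  have sb : Sn b ≠ 0 := hn 1
  have sc : Sn c ≠ 0 := hn 2
  have sd : Sn d ≠ 0 := hn 3
  have se : Sn e ≠ 0 := hn 4
  have sea : Sn (e - a) ≠ 0 := hn' 4 0 (by decide)
  have seb : Sn (e - b) ≠ 0 := hn' 4 1 (by decide)
  have sec : Sn (e - c) ≠ 0 := hn' 4 2 (by decide)
  have sed : Sn (e - d) ≠ 0 := hn' 4 3 (by decide)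
  have sfa : Sn (f - a) ≠ 0 := hn' 5 0 (by decide)
  have sfb : Sn (f - b) ≠ 0 := hn' 5 1 (by decide)
  have sfc : Sn (f - c) ≠ 0 := hn' 5 2 (by decide)
  have sfd : Sn (f - d) ≠ 0 := hn' 5 3 (by decide)
  have sga : Sn (g - a) ≠ 0 := hn' 6 0 (by decide)
  have sgb : Sn (g - b) ≠ 0 := hn' 6 1 (by decide)
  have sgc : Sn (g - c) ≠ 0 := hn' 6 2 (by decide)
  have sgd : Sn (g - d) ≠ 0 := hn' 6 3 (by decide)
  obtain ⟨W, hWdef⟩ : ∃ W : ℂ → ℂ, ∀ s,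
      bilatF a c (f - b) (f - d) f (1 + a + c - g) (1 + a + c - e) s = W s := ⟨_, fun _ => rfl⟩
  have hK₁ := Kf_eq_bilatF hsaal sa sb sc sd (by rwa [hs]) (by rwa [hs]) (by rwa [hs]) sfb sfd
    sgc sec
  have hK₂ := Kf_eq_bilatF (a := e - a) (b := e - b) (c := e - c) (d := e - d) (e := e)
    (f := 1 + e - g) (g := 1 + e - f) (by linear_combination -hsaal) sea seb sec sed
    (by rwa [show 1 + (e - a) - e = 1 - a by ring, Sn_one_sub])
    (by rwa [show 1 + (e - a) - (1 + e - g) = g - a by ring])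
    (by rwa [show 1 + (e - a) - (1 + e - f) = f - a by ring])
    (by rwa [show 1 + e - g - (e - b) = 1 + b - g by ring, hs])
    (by rwa [show 1 + e - g - (e - d) = 1 + d - g by ring, hs])
    (by rwa [show 1 + e - f - (e - c) = 1 + c - f by ring, hs])
    (by rwa [show e - (e - c) = c by ring])
  have hK₃ := Kf_eq_bilatF (a := 1 + b - e) (b := 1 + a - e) (c := 1 + d - e) (d := 1 + c - e)
    (e := 2 - e) (f := 1 + g - e) (g := 1 + f - e) (by linear_combination hsaal) (by rwa [hs])
    (by rwa [hs]) (by rwa [hs]) (by rwa [hs])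
    (by rwa [show 1 + (1 + b - e) - (2 - e) = b by ring])
    (by rwa [show 1 + (1 + b - e) - (1 + g - e) = 1 + b - g by ring, hs])
    (by rwa [show 1 + (1 + b - e) - (1 + f - e) = 1 + b - f by ring, hs])
    (by rwa [show 1 + g - e - (1 + a - e) = g - a by ring])
    (by rwa [show 1 + g - e - (1 + c - e) = g - c by ring])
    (by rwa [show 1 + f - e - (1 + d - e) = f - d by ring])
    (by rwa [show 2 - e - (1 + d - e) = 1 - d by ring, Sn_one_sub])
  rw [hWdef, hWdef, hs] at hK₁
  rw [bilatF_shift hsaal, bilatF_shift hsaal, hWdef, hWdef,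
    show 1 + e - g - (e - b) = 1 + b - g by ring, show 1 + e - g - (e - d) = 1 + d - g by ring,
    show 1 + e - f - (e - c) = 1 + c - f by ring, show e - (e - c) = c by ring,
    show 1 + (e - a) - (1 + e - g) = g - a by ring, hs, hs, hs, add_zero,
    show e - a - c + -(e - a) = -c by ring] at hK₂
  rw [bilatF_shift' hsaal, bilatF_shift' hsaal, hWdef, hWdef,
    show 1 + g - e - (1 + a - e) = g - a by ring, show 1 + g - e - (1 + c - e) = g - c by ring,
    show 1 + f - e - (1 + d - e) = f - d by ring, show 2 - e - (1 + d - e) = 1 - d by ring,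
    show 1 + (1 + b - e) - (1 + g - e) = 1 + b - g by ring, Sn_one_sub, hs, hs, hs, add_zero,
    show g - a - c + -(1 + b - e) = d - f by linear_combination hsaal] at hK₃
  have key := three_term_of_laurent hsaal (W := W) (by
    simp only [← hWdef]
    refine bilat_eq_laurent ?_
    simp only [Fin.sum_univ_four, Matrix.cons_val]
    linear_combination -hsaal)
  have r₁ := inv_Gamma_mul_inv_Gamma (show a + (1 - a) = 1 by ring)
  have r₂ := inv_Gamma_mul_inv_Gamma (show f - a + (1 + a - f) = 1 by ring)
  have r₃ := inv_Gamma_mul_inv_Gamma (show f - b + (1 + b - f) = 1 by ring)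
  have r₄ := inv_Gamma_mul_inv_Gamma (show e - a + (1 + a - e) = 1 by ring)
  have r₅ := inv_Gamma_mul_inv_Gamma (show g - d + (1 + d - g) = 1 by ring)
  have r₆ := inv_Gamma_mul_inv_Gamma (show f - c + (1 + c - f) = 1 by ring)
  have r₇ := inv_Gamma_mul_inv_Gamma (show d + (1 - d) = 1 by ring)
  have r₈ := inv_Gamma_mul_inv_Gamma (show e - b + (1 + b - e) = 1 by ring)
  have r₉ := inv_Gamma_mul_inv_Gamma (show e - d + (1 + d - e) = 1 by ring)
  have hpi : (Real.pi : ℂ) ≠ 0 := by exact_mod_cast Real.pi_ne_zero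
  rw [Kf_swap_right (e - a), Kf_swap_left (1 + b - e), Kf_swap_right (1 + b - e), hK₁, hK₂, hK₃]
  simp only [B5, Af]
  rw [show 1 + b - a - b = 1 - a by ring, Sn_one_sub, show 1 + a + b - e - b = 1 + a - e by ring,
    hs a e]
  set Q := (Gamma a)⁻¹ * (Gamma (e - a))⁻¹ * (Gamma (g - a))⁻¹ * (Gamma b)⁻¹ *
    (Gamma (1 + b - e))⁻¹ * (Gamma (1 + b - g))⁻¹ * (Gamma c)⁻¹ * (Gamma (f - d))⁻¹ *
    (Gamma (g - c))⁻¹ * (Gamma (e - c))⁻¹ with hQ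
  rw [reflection_cancel hpi sa (Q := Q) (s₂ := Sn (f - a)) (s₃ := Sn (f - b))
      (by rw [← r₁, ← r₂, ← r₃, hQ]; simp only [one_div, mul_inv]; ring),
    reflection_cancel hpi sea (Q := Q) (s₂ := Sn (g - d)) (s₃ := Sn (f - c))
      (by rw [← r₄, ← r₅, ← r₆, hQ]; simp only [one_div, mul_inv]; ring),
    reflection_cancel hpi seb (Q := Q) (s₂ := Sn d) (s₃ := Sn (e - d))
      (by rw [← r₇, ← r₈, ← r₉, hQ]; simp only [one_div, mul_inv]; ring)]
  clear_value Q
  generalize Sn (b - (e - a)) * _ * _ + _ = X₁ at key ⊢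
  generalize Sn (b - (1 + b - e)) * _ * _ + _ = X₂ at key ⊢
  generalize Sn (b - a) * _ * _ + _ = X₃ at key ⊢
  refine Eq.trans ?_ ((congrArg (Q * Sn b / Real.pi ^ 3 / (Sn c * Sn (f - d) * Sn (g - c) *
    Sn (e - c) * Sn (g - b) * Sn (g - a)) * ·) key).trans (mul_zero _))
  field_simp
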